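/- arXiv:1204.0494 — 10 statements merged into one kernel-verified Lean document; each statement's English description precedes it below -/
import Mathlib

section
/- For any finite simple graphs G and H (with nonempty vertex sets and without isolated vertices, so that the quantities are defined), the global offensive alliance number of the Cartesian product satisfies γo(G □ H) ≥ (1/2) · max{ γ(G)·γo(H), γo(G)·γ(H) }, where γ denotes the domination number and γo the global offensive alliance number. -/
open SimpleGraph

/-- `S` is a global offensive alliance in `G`: every vertex outside `S` has at least
one more neighbor inside `S` than outside `S`. -/
def IsGlobalOffensiveAlliance {V : Type*} (G : SimpleGraph V) (S : Set V) : Prop :=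
  ∀ v ∉ S, (G.neighborSet v ∩ S).ncard ≥ (G.neighborSet v \ S).ncard + 1

/-- `S` is a global strong offensive alliance in `G`. -/
def IsGlobalStrongOffensiveAlliance {V : Type*} (G : SimpleGraph V) (S : Set V) : Prop :=
  ∀ v ∉ S, (G.neighborSet v ∩ S).ncard ≥ (G.neighborSet v \ S).ncard

/-- The global offensive alliance number `γₒ(G)`. -/
noncomputable def globalOffensiveAllianceNumber {V : Type*} (G : SimpleGraph V) : ℕ :=
  sInf {n | ∃ S : Set V, IsGlobalOffensiveAlliance G S ∧ S.ncard = n}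

/-- `S` is a dominating set in `G`. -/
def IsDominatingSet {V : Type*} (G : SimpleGraph V) (S : Set V) : Prop :=
  ∀ v ∉ S, ∃ u ∈ S, G.Adj u v

/-- The domination number `γ(G)`. -/
noncomputable def dominationNumber {V : Type*} (G : SimpleGraph V) : ℕ :=
  sInf {n | ∃ S : Set V, IsDominatingSet G S ∧ S.ncard = n}

/-- `S` is an efficient dominating set: a dominating set whose closed neighborhoods
are pairwise disjoint. -/
def IsEfficientDominatingSet {V : Type*} (G : SimpleGraph V) (S : Set V) : Prop :=
  IsDominatingSet G S ∧
    S.Pairwise fun u w =>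
      Disjoint (insert u (G.neighborSet u)) (insert w (G.neighborSet w))

/-- The number of neighbors of `w` in `T` exceeds the number of neighbors outside `T`. -/
def IsOffended {W : Type*} (H : SimpleGraph W) (T : Set W) (w : W) : Prop :=
  (H.neighborSet w ∩ T).ncard ≥ (H.neighborSet w \ T).ncard + 1

theorem IsOffended.mono {W : Type*} [Finite W] {H : SimpleGraph W} {T T' : Set W} {w : W}
    (h : IsOffended H T w) (hT : T ⊆ T') : IsOffended H T' w := by
  have h₁ : (H.neighborSet w ∩ T).ncard ≤ (H.neighborSet w ∩ T').ncard :=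
    Set.ncard_le_ncard (Set.inter_subset_inter_right _ hT)
  have h₂ : (H.neighborSet w \ T').ncard ≤ (H.neighborSet w \ T).ncard :=
    Set.ncard_le_ncard (Set.sdiff_subset_sdiff_right hT)
  unfold IsOffended at *
  omega

theorem IsOffended.exists_adj {W : Type*} {H : SimpleGraph W} {T : Set W} {w : W}
    (h : IsOffended H T w) : ∃ u ∈ T, H.Adj u w := by
  have hne : (H.neighborSet w ∩ T).Nonempty := by
    apply Set.nonempty_of_ncard_ne_zero
    unfold IsOffended at h
    omega
  obtain ⟨u, hu, huT⟩ := hne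
  exact ⟨u, huT, hu.symm⟩

theorem ncard_neighborSet_boxProd_inter {V W : Type*} [Finite V] [Finite W]
    (G : SimpleGraph V) (H : SimpleGraph W) (T : Set (V × W)) (v : V) (w : W) :
    ((G.boxProd H).neighborSet (v, w) ∩ T).ncard =
      (G.neighborSet v ∩ {a | (a, w) ∈ T}).ncard + (H.neighborSet w ∩ {b | (v, b) ∈ T}).ncard := by
  have hG : Function.Injective (fun a : V => (a, w)) := fun a b h => (Prod.ext_iff.1 h).1
  have hH : Function.Injective (fun b : W => (v, b)) := fun a b h => (Prod.ext_iff.1 h).2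
  rw [← Set.ncard_image_of_injective _ hG, ← Set.ncard_image_of_injective _ hH,
    ← Set.ncard_union_eq]
  · congr 1
    ext ⟨a, b⟩
    simp only [Set.mem_inter_iff, mem_neighborSet, boxProd_adj, Set.mem_union, Set.mem_image,
      Set.mem_ofPred_eq, Prod.mk.injEq]
    constructor
    · rintro ⟨⟨h, rfl⟩ | ⟨h, rfl⟩, hT⟩
      · exact Or.inl ⟨a, ⟨h, hT⟩, rfl, rfl⟩
      · exact Or.inr ⟨b, ⟨h, hT⟩, rfl, rfl⟩
    · rintro (⟨a, ⟨h, hT⟩, rfl, rfl⟩ | ⟨b, ⟨h, hT⟩, rfl, rfl⟩)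
      · exact ⟨Or.inl ⟨h, rfl⟩, hT⟩
      · exact ⟨Or.inr ⟨h, rfl⟩, hT⟩
  · rw [Set.disjoint_left]
    rintro _ ⟨a, ⟨h, -⟩, rfl⟩ ⟨b, -, h'⟩
    obtain rfl : v = a := (Prod.ext_iff.1 h').1
    exact G.irrefl h

theorem IsGlobalOffensiveAlliance.isOffended_or {V W : Type*} [Finite V] [Finite W]
    {G : SimpleGraph V} {H : SimpleGraph W} {S : Set (V × W)}
    (hS : IsGlobalOffensiveAlliance (G.boxProd H) S) {v : V} {w : W} (h : (v, w) ∉ S) :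
    IsOffended G {a | (a, w) ∈ S} v ∨ IsOffended H {b | (v, b) ∈ S} w := by
  have h₀ := hS _ h
  rw [ncard_neighborSet_boxProd_inter, Set.sdiff_eq, ncard_neighborSet_boxProd_inter] at h₀
  have hG : (G.neighborSet v \ {a | (a, w) ∈ S}) = G.neighborSet v ∩ {a | (a, w) ∈ Sᶜ} := rfl
  have hH : (H.neighborSet w \ {b | (v, b) ∈ S}) = H.neighborSet w ∩ {b | (v, b) ∈ Sᶜ} := rfl
  unfold IsOffended
  rw [hG, hH]
  omega

theorem exists_isDominatingSet_ncard_eq {V : Type*} (G : SimpleGraph V) :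
    ∃ D : Set V, IsDominatingSet G D ∧ D.ncard = dominationNumber G :=
  Nat.sInf_mem (s := {n | ∃ S : Set V, IsDominatingSet G S ∧ S.ncard = n})
    ⟨_, Set.univ, fun v hv => (hv (Set.mem_univ v)).elim, rfl⟩

theorem exists_isGlobalOffensiveAlliance_ncard_eq {V : Type*} (G : SimpleGraph V) :
    ∃ S : Set V, IsGlobalOffensiveAlliance G S ∧ S.ncard = globalOffensiveAllianceNumber G :=
  Nat.sInf_mem (s := {n | ∃ S : Set V, IsGlobalOffensiveAlliance G S ∧ S.ncard = n})
    ⟨_, Set.univ, fun v hv => (hv (Set.mem_univ v)).elim, rfl⟩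

theorem dominationNumber_le_card {V : Type*} {G : SimpleGraph V} {D : Finset V}
    (hD : IsDominatingSet G D) : dominationNumber G ≤ D.card :=
  Nat.sInf_le ⟨D, hD, Set.ncard_coe_finset D⟩

theorem globalOffensiveAllianceNumber_le_card {V : Type*} {G : SimpleGraph V} {S : Finset V}
    (hS : IsGlobalOffensiveAlliance G S) : globalOffensiveAllianceNumber G ≤ S.card :=
  Nat.sInf_le ⟨S, hS, Set.ncard_coe_finset S⟩

open Classical in
theorem dominationNumber_mul_globalOffensiveAllianceNumber_le {V W : Type*}
    [Fintype V] [Fintype W] (G : SimpleGraph V) (H : SimpleGraph W) (S : Finset (V × W))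
    (hS : ∀ v w, (v, w) ∉ S →
      IsOffended G {a | (a, w) ∈ S} v ∨ IsOffended H {b | (v, b) ∈ S} w) :
    dominationNumber G * globalOffensiveAllianceNumber H ≤ 2 * S.card := by
  obtain ⟨D', hD', hcard⟩ := exists_isDominatingSet_ncard_eq G
  obtain ⟨D, rfl⟩ : ∃ D : Finset V, (D : Set V) = D' := ⟨D'.toFinset, by simp⟩
  rw [Set.ncard_coe_finset] at hcard
  have hf : ∀ v, ∃ u ∈ D, u = v ∨ G.Adj u v := fun v => by
    by_cases hv : v ∈ D
    · exact ⟨v, hv, Or.inl rfl⟩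
    · obtain ⟨u, hu, h⟩ := hD' v (by simpa using hv)
      exact ⟨u, by simpa using hu, Or.inr h⟩
  choose f hfD hf using hf
  let B : V → W → Prop := fun i w =>
    ∀ v, f v = i → (v, w) ∉ S ∧ ∃ u, (u, w) ∈ S ∧ G.Adj u v
  let P : V → Finset W := fun i => (S.filter fun p => f p.1 = i).image Prod.snd
  have hrow : ∀ i ∈ D, globalOffensiveAllianceNumber H ≤
      (S.filter fun p => f p.1 = i).card + (Finset.univ.filter fun w => B i w).card := by
    intro i _
    refine le_trans (globalOffensiveAllianceNumber_le_card
      (S := P i ∪ Finset.univ.filter fun w => B i w) ?_) <|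
      (Finset.card_union_le _ _).trans (Nat.add_le_add_right Finset.card_image_le _)
    intro w hw
    rw [Finset.mem_coe, Finset.mem_union, not_or] at hw
    obtain ⟨hwP, hwB⟩ := hw
    have hnot : ∀ v, f v = i → (v, w) ∉ S := fun v hv hvS =>
      hwP (Finset.mem_image.2 ⟨(v, w), Finset.mem_filter.2 ⟨hvS, hv⟩, rfl⟩)
    simp only [Finset.mem_filter, Finset.mem_univ, true_and] at hwB
    obtain ⟨v, hv, hdom⟩ : ∃ v, f v = i ∧ ¬ ∃ u, (u, w) ∈ S ∧ G.Adj u v := by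
      by_contra! hcon
      exact hwB fun v hv => ⟨hnot v hv, hcon v hv⟩
    rcases hS v w (hnot v hv) with h | h
    · exact (hdom h.exists_adj).elim
    · refine h.mono fun b hb => ?_
      rw [Finset.mem_coe, Finset.mem_union]
      exact Or.inl (Finset.mem_image.2 ⟨(v, b), Finset.mem_filter.2 ⟨hb, hv⟩, rfl⟩)
  have hcol : ∀ w, (D.filter fun i => B i w).card ≤ (S.filter fun p => p.2 = w).card := by
    intro w
    have hdom : IsDominatingSet G (((S.filter fun p => p.2 = w).image Prod.fst ∪
        D.filter fun i => ¬ B i w : Finset V) : Set V) := by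
      intro v hv
      rw [Finset.mem_coe, Finset.mem_union, not_or] at hv
      by_cases hB : B (f v) w
      · obtain ⟨-, u, hu, huv⟩ := hB v rfl
        refine ⟨u, ?_, huv⟩
        rw [Finset.mem_coe, Finset.mem_union]
        exact Or.inl (Finset.mem_image.2 ⟨(u, w), Finset.mem_filter.2 ⟨hu, rfl⟩, rfl⟩)
      · have hmem : f v ∈ D.filter fun i => ¬ B i w := Finset.mem_filter.2 ⟨hfD v, hB⟩
        refine ⟨f v, ?_, (hf v).resolve_left fun h => hv.2 (h ▸ hmem)⟩
        rw [Finset.mem_coe, Finset.mem_union]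
        exact Or.inr hmem
    have h₁ := dominationNumber_le_card hdom
    have h₂ := Finset.card_union_le ((S.filter fun p => p.2 = w).image Prod.fst)
      (D.filter fun i => ¬ B i w)
    have h₃ : ((S.filter fun p => p.2 = w).image Prod.fst).card ≤ _ := Finset.card_image_le
    have h₄ := Finset.card_filter_add_card_filter_not (s := D) (fun i => B i w)
    omega
  calc dominationNumber G * globalOffensiveAllianceNumber H
      = ∑ i ∈ D, globalOffensiveAllianceNumber H := by simp [hcard]
    _ ≤ ∑ i ∈ D, ((S.filter fun p => f p.1 = i).card +
          (Finset.univ.filter fun w => B i w).card) := Finset.sum_le_sum hrow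
    _ = S.card + ∑ w, (D.filter fun i => B i w).card := by
        rw [Finset.sum_add_distrib,
          ← Finset.card_eq_sum_card_fiberwise (f := fun p : V × W => f p.1)
            fun p _ => hfD p.1]
        congr 1
        exact Finset.sum_card_bipartiteAbove_eq_sum_card_bipartiteBelow B
    _ ≤ S.card + ∑ w, (S.filter fun p => p.2 = w).card :=
        Nat.add_le_add_left (Finset.sum_le_sum fun w _ => hcol w) _
    _ = 2 * S.card := by
        rw [← Finset.card_eq_sum_card_fiberwise (f := fun p : V × W => p.2) fun p _ => by simp,
          two_mul]

theorem stmt0 {V W : Type*} [Fintype V] [Fintype W] [Nonempty V] [Nonempty W]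
    (G : SimpleGraph V) (H : SimpleGraph W)
    (hG : ∀ v : V, ∃ u : V, G.Adj v u) (hH : ∀ v : W, ∃ u : W, H.Adj v u) :
    (globalOffensiveAllianceNumber (G.boxProd H) : ℚ) ≥
      (max (dominationNumber G * globalOffensiveAllianceNumber H)
           (globalOffensiveAllianceNumber G * dominationNumber H) : ℚ) / 2 := by
  classical
  obtain ⟨S', hS', hcard⟩ := exists_isGlobalOffensiveAlliance_ncard_eq (G.boxProd H)
  obtain ⟨S, rfl⟩ : ∃ S : Finset (V × W), (S : Set (V × W)) = S' := ⟨S'.toFinset, by simp⟩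
  rw [Set.ncard_coe_finset] at hcard
  have h₁ := dominationNumber_mul_globalOffensiveAllianceNumber_le G H S
    fun v w h => hS'.isOffended_or (by simpa using h)
  have h₂ := dominationNumber_mul_globalOffensiveAllianceNumber_le H G
    (S.map (Equiv.prodComm V W).toEmbedding) fun w v h => by
      simpa using (hS'.isOffended_or (v := v) (w := w) (by simpa using h)).symm
  rw [Finset.card_map, mul_comm] at h₂
  rw [hcard] at h₁ h₂
  rw [ge_iff_le, div_le_iff₀ two_pos, mul_comm _ (2 : ℚ)]
  exact max_le (by exact_mod_cast h₁) (by exact_mod_cast h₂)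
end

section
/- Let G and H be finite simple graphs. If G has an efficient dominating set, i.e., a dominating set whose closed neighborhoods are pairwise disjoint, then γo(G □ H) ≥ γ(G)·γo(H), where γ denotes the domination number and γo the global offensive alliance number. -/
open SimpleGraph

/-- Projecting the part of a global offensive alliance of `G □ H` above a closed neighborhood
of `G` gives a global offensive alliance of `H`. -/
theorem IsGlobalOffensiveAlliance.image_snd_closedNeighborhood {V W : Type*} [Finite V] [Finite W]
    {G : SimpleGraph V} {H : SimpleGraph W} {S : Set (V × W)}
    (hS : IsGlobalOffensiveAlliance (G.boxProd H) S) (u : V) :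
    IsGlobalOffensiveAlliance H
      (Prod.snd '' (S ∩ Prod.fst ⁻¹' (insert u (G.neighborSet u)))) := by
  intro w hw
  set T := Prod.snd '' (S ∩ Prod.fst ⁻¹' (insert u (G.neighborSet u)))
  have mem_T : ∀ x y, (x, y) ∈ S → x = u ∨ G.Adj u x → y ∈ T :=
    fun x y hxy hx => ⟨(x, y), ⟨hxy, hx⟩, rfl⟩
  have fst_eq : ∀ p ∈ (G.boxProd H).neighborSet (u, w) ∩ S, H.Adj w p.2 ∧ u = p.1 := by
    rintro ⟨x, y⟩ ⟨hadj, hxy⟩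
    rw [mem_neighborSet, boxProd_adj] at hadj
    rcases hadj with ⟨hux, rfl⟩ | h
    · exact absurd (mem_T _ _ hxy (Or.inr hux)) hw
    · exact h
  have inside : ((G.boxProd H).neighborSet (u, w) ∩ S).ncard ≤ (H.neighborSet w ∩ T).ncard := by
    refine Set.ncard_le_ncard_of_injOn Prod.snd ?_ ?_ (Set.toFinite _)
    · intro p hp
      exact ⟨(fst_eq p hp).1, mem_T p.1 p.2 hp.2 (Or.inl (fst_eq p hp).2.symm)⟩
    · intro p hp q hq hpq
      exact Prod.ext ((fst_eq p hp).2.symm.trans (fst_eq q hq).2) hpq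
  have outside : (H.neighborSet w \ T).ncard ≤ ((G.boxProd H).neighborSet (u, w) \ S).ncard := by
    refine Set.ncard_le_ncard_of_injOn (fun y => (u, y)) ?_ ?_ (Set.toFinite _)
    · intro y hy
      exact ⟨boxProd_adj.2 (Or.inr ⟨hy.1, rfl⟩), fun h => hy.2 (mem_T u y h (Or.inl rfl))⟩
    · intro y _ z _ h
      exact congrArg Prod.snd h
  have := hS (u, w) fun h => hw (mem_T u w h (Or.inl rfl))
  omega

theorem globalOffensiveAllianceNumber_le_ncard {V : Type*} {G : SimpleGraph V} {S : Set V}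
    (hS : IsGlobalOffensiveAlliance G S) : globalOffensiveAllianceNumber G ≤ S.ncard :=
  Nat.sInf_le ⟨S, hS, rfl⟩

theorem dominationNumber_le_ncard {V : Type*} {G : SimpleGraph V} {S : Set V}
    (hS : IsDominatingSet G S) : dominationNumber G ≤ S.ncard :=
  Nat.sInf_le ⟨S, hS, rfl⟩

/-- If the parts of `S` above the members of a disjoint family `N` indexed by `D` all have at
least `k` elements, then `S` has at least `D.ncard * k` elements. -/
theorem ncard_mul_le_ncard_of_pairwise_disjoint {ι α V : Type*} [Finite ι] [Finite α]
    {D : Set ι} {S : Set α} {N : ι → Set V} {f : α → V} {k : ℕ}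
    (hD : D.Pairwise fun i j => Disjoint (N i) (N j))
    (hk : ∀ i ∈ D, k ≤ (S ∩ f ⁻¹' N i).ncard) : D.ncard * k ≤ S.ncard := by
  classical
  have := Fintype.ofFinite ι
  have := Fintype.ofFinite α
  have hdisj : (D.toFinset : Set ι).PairwiseDisjoint
      fun i => (S ∩ f ⁻¹' N i).toFinset := by
    intro i hi j hj hij
    rw [Function.onFun, Set.disjoint_toFinset]
    exact ((hD (by simpa using hi) (by simpa using hj) hij).preimage f).mono
      Set.inter_subset_right Set.inter_subset_right
  rw [Set.ncard_eq_toFinset_card' D, Set.ncard_eq_toFinset_card' S, ← smul_eq_mul]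
  calc D.toFinset.card • k
      ≤ ∑ i ∈ D.toFinset, (S ∩ f ⁻¹' N i).toFinset.card :=
        Finset.card_nsmul_le_sum _ _ _ fun i hi => by
          rw [← Set.ncard_eq_toFinset_card']
          exact hk i (Set.mem_toFinset.1 hi)
    _ = (D.toFinset.biUnion fun i => (S ∩ f ⁻¹' N i).toFinset).card :=
        (Finset.card_biUnion hdisj).symm
    _ ≤ S.toFinset.card := Finset.card_le_card <| Finset.biUnion_subset.2 fun i _ =>
        Set.toFinset_mono Set.inter_subset_left

theorem stmt1 {V W : Type*} [Fintype V] [Fintype W]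
    (G : SimpleGraph V) (H : SimpleGraph W)
    (hS : ∃ S : Set V, IsEfficientDominatingSet G S) :
    globalOffensiveAllianceNumber (G.boxProd H) ≥
      dominationNumber G * globalOffensiveAllianceNumber H := by
  obtain ⟨D, hdom, hdisj⟩ := hS
  obtain ⟨S, hall, hcard⟩ := exists_isGlobalOffensiveAlliance_ncard_eq (G.boxProd H)
  rw [← hcard]
  refine (Nat.mul_le_mul_right _ (dominationNumber_le_ncard hdom)).trans
    (ncard_mul_le_ncard_of_pairwise_disjoint (f := Prod.fst) hdisj fun u _ => ?_)
  exact (globalOffensiveAllianceNumber_le_ncard (hall.image_snd_closedNeighborhood u)).trans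
    (Set.ncard_image_le (Set.toFinite _))
end

section
/- A finite connected simple graph G contains an efficient dominating set of minimum cardinality (i.e., of cardinality γ(G)) which is also a global offensive alliance if and only if G is a star graph S_{1,n} (a graph consisting of one central vertex adjacent to n ≥ 0 leaves, with no other edges). -/
open SimpleGraph

section

variable {V : Type*} {G : SimpleGraph V}

/-- `G` is a star centered at `c`. -/
def IsStarAt (G : SimpleGraph V) (c : V) : Prop :=
  ∀ u v, G.Adj u v ↔ u = c ∧ v ≠ c ∨ u ≠ c ∧ v = c

theorem IsStarAt.exists_iso [Finite V] {c : V} (h : IsStarAt G c) :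
    ∃ n : ℕ, Nonempty (G ≃g completeBipartiteGraph (Fin 1) (Fin n)) := by
  classical
  obtain ⟨n, ⟨e⟩⟩ := Finite.exists_equiv_fin {v : V // ¬ v = c}
  refine ⟨n, ⟨RelIso.symm ⟨(((Equiv.ofUnique (Fin 1) {v : V // v = c}).sumCongr e.symm).trans
    (Equiv.sumCompl (· = c))), ?_⟩⟩⟩
  have hc : ((default : {v : V // v = c}) : V) = c := (default : {v : V // v = c}).2
  have hl (i : Fin n) : ((e.symm i : {v : V // ¬ v = c}) : V) ≠ c := (e.symm i).2
  rintro (a | a) (b | b) <;> simp [h _ _, hc, hl]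

theorem exists_isStarAt_of_iso {n : ℕ}
    (e : G ≃g completeBipartiteGraph (Fin 1) (Fin n)) : ∃ c, IsStarAt G c := by
  refine ⟨e.symm (Sum.inl 0), fun u v => ?_⟩
  have key (w : V) : w = e.symm (Sum.inl 0) ↔ e w = Sum.inl 0 :=
    e.toEquiv.eq_symm_apply
  rw [ne_eq, ne_eq, key, key, ← e.map_adj_iff]
  generalize e u = a
  generalize e v = b
  rcases a with a | a <;> rcases b with b | b <;>
    simp [Subsingleton.elim _ (0 : Fin 1)]

theorem IsDominatingSet.nonempty [Nonempty V] {S : Set V} (hS : IsDominatingSet G S) :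
    S.Nonempty := by
  by_contra hne
  obtain ⟨v⟩ := ‹Nonempty V›
  by_cases hv : v ∈ S
  · exact hne ⟨v, hv⟩
  · obtain ⟨u, hu, -⟩ := hS v hv
    exact hne ⟨u, hu⟩

theorem dominationNumber_eq_one [Finite V] {c : V} (hc : IsDominatingSet G {c}) :
    dominationNumber G = 1 := by
  have : Nonempty V := ⟨c⟩
  refine le_antisymm (Nat.sInf_le ⟨{c}, hc, Set.ncard_singleton c⟩) ?_
  refine le_csInf ⟨1, {c}, hc, Set.ncard_singleton c⟩ ?_
  rintro m ⟨S, hS, rfl⟩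
  exact (Set.ncard_pos).2 hS.nonempty

theorem IsStarAt.isDominatingSet {c : V} (h : IsStarAt G c) : IsDominatingSet G {c} :=
  fun v hv => ⟨c, rfl, (h c v).2 (.inl ⟨rfl, hv⟩)⟩

theorem IsStarAt.isGlobalOffensiveAlliance {c : V} (h : IsStarAt G c) :
    IsGlobalOffensiveAlliance G {c} := by
  intro v hv
  have hN : G.neighborSet v = {c} := by
    ext w
    rw [Set.mem_singleton_iff] at hv
    simp [h v w, hv]
  simp [hN]

theorem IsEfficientDominatingSet.eq_of_adj {S : Set V} (hS : IsEfficientDominatingSet G S)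
    {u w x : V} (hu : u ∈ S) (hw : w ∈ S) (hux : x = u ∨ G.Adj u x) (hwx : x = w ∨ G.Adj w x) :
    u = w := by
  by_contra hne
  exact Set.disjoint_left.1 (hS.2 hu hw hne) hux hwx

theorem IsEfficientDominatingSet.notMem_of_adj {S : Set V} (hS : IsEfficientDominatingSet G S)
    {u v : V} (hu : u ∈ S) (huv : G.Adj u v) : v ∉ S :=
  fun hv => huv.ne (hS.eq_of_adj hu hv (.inr huv) (.inl rfl))

theorem IsEfficientDominatingSet.mem_of_adj [Finite V] {S : Set V}
    (hS : IsEfficientDominatingSet G S) (hA : IsGlobalOffensiveAlliance G S)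
    {u v : V} (hu : u ∉ S) (huv : G.Adj u v) : v ∈ S := by
  by_contra hv
  have hin : (G.neighborSet u ∩ S).ncard ≤ 1 :=
    (Set.ncard_le_one).2 fun a ha b hb =>
      hS.eq_of_adj ha.2 hb.2 (.inr (G.adj_symm ha.1)) (.inr (G.adj_symm hb.1))
  have hout : 0 < (G.neighborSet u \ S).ncard := (Set.ncard_pos).2 ⟨v, huv, hv⟩
  have := hA u hu
  omega

theorem IsEfficientDominatingSet.isStarAt [Finite V] (hG : G.Connected) {S : Set V}
    (hS : IsEfficientDominatingSet G S) (hA : IsGlobalOffensiveAlliance G S)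
    {c : V} (hc : c ∈ S) : IsStarAt G c := by
  have hstep {x y : V} (hx : x = c ∨ G.Adj c x) (hxy : G.Adj x y) : y = c ∨ G.Adj c y := by
    rcases hx with rfl | hx
    · exact .inr hxy
    · have hy := hS.mem_of_adj hA (hS.notMem_of_adj hc hx) hxy
      exact .inl (hS.eq_of_adj hy hc (.inr hxy.symm) (.inr hx))
  have hwalk {x y : V} (p : G.Walk x y) (hx : x = c ∨ G.Adj c x) : y = c ∨ G.Adj c y := by
    induction p with
    | nil => exact hx
    | cons hxy _ ih => exact ih (hstep hx hxy)
  have hall (v : V) : v = c ∨ G.Adj c v :=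
    (hG.preconnected c v).elim fun p => hwalk p (.inl rfl)
  intro u v
  constructor
  · intro huv
    by_cases hu : u = c
    · exact .inl ⟨hu, fun hv => huv.ne (hu.trans hv.symm)⟩
    · refine .inr ⟨hu, ?_⟩
      have hcu := (hall u).resolve_left hu
      have hv := hS.mem_of_adj hA (hS.notMem_of_adj hc hcu) huv
      exact hS.eq_of_adj hv hc (.inr huv.symm) (.inr hcu)
  · rintro (⟨rfl, hv⟩ | ⟨hu, rfl⟩)
    · exact (hall v).resolve_left hv
    · exact ((hall u).resolve_left hu).symm

end

theorem stmt2 {V : Type*} [Fintype V] (G : SimpleGraph V) (hG : G.Connected) :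
    (∃ S : Set V, IsEfficientDominatingSet G S ∧ S.ncard = dominationNumber G ∧
        IsGlobalOffensiveAlliance G S) ↔
      ∃ n : ℕ, Nonempty (G ≃g completeBipartiteGraph (Fin 1) (Fin n)) := by
  constructor
  · rintro ⟨S, hS, -, hA⟩
    have := hG.nonempty
    obtain ⟨c, hc⟩ := hS.1.nonempty
    exact (hS.isStarAt hG hA hc).exists_iso
  · rintro ⟨n, ⟨e⟩⟩
    obtain ⟨c, h⟩ := exists_isStarAt_of_iso e
    refine ⟨{c}, ⟨h.isDominatingSet, Set.pairwise_singleton _ _⟩, ?_, h.isGlobalOffensiveAlliance⟩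
    rw [dominationNumber_eq_one h.isDominatingSet, Set.ncard_singleton]
end

section
/- Let C_n be the cycle graph on n ≥ 3 vertices. For every finite simple graph G without isolated vertices, γo(G □ C_n) ≥ ⌈n·γo(G)/2⌉, where γo denotes the global offensive alliance number. -/
open SimpleGraph

/-- The layer of a vertex set of a box product over the vertex `i` of the second factor. -/
def boxLayer {V W : Type*} (S : Set (V × W)) (i : W) : Set V := {v | (v, i) ∈ S}

theorem ncard_eq_sum_ncard_boxLayer {V W : Type*} [Finite V] [Fintype W] (S : Set (V × W)) :
    S.ncard = ∑ i, (boxLayer S i).ncard := by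
  have h (i : W) : Nat.card (boxLayer S i) = (boxLayer S i).ncard := Nat.card_coe_set_eq _
  simp_rw [← h, ← Nat.card_sigma, ← Nat.card_coe_set_eq S]
  exact Nat.card_congr
    { toFun := fun p => ⟨p.1.2, p.1.1, p.2⟩
      invFun := fun q => ⟨(q.2.1, q.1), q.2.2⟩ }

/-- If every neighbor of `i` is `j` or `k`, a vertex of the `i`-th layer outside the alliance
whose copy in the `j`-th layer is also outside is protected within its own layer. -/
theorem IsGlobalOffensiveAlliance.ncard_boxLayer_le {V W : Type*} [Finite V] [Finite W]
    {G : SimpleGraph V} {H : SimpleGraph W} {S : Set (V × W)}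
    (hS : IsGlobalOffensiveAlliance (G.boxProd H) S) {i j k : W} (hij : H.Adj i j)
    (hi : ∀ x, H.Adj i x → x = j ∨ x = k) {v : V} (hvi : v ∉ boxLayer S i)
    (hvj : v ∉ boxLayer S j) :
    (G.neighborSet v \ boxLayer S i).ncard + 1 ≤ (G.neighborSet v ∩ boxLayer S i).ncard := by
  have inj : Function.Injective fun u : V => (u, i) := fun a b h => (Prod.ext_iff.1 h).1
  have h := hS (v, i) hvi
  have h1 : (G.boxProd H).neighborSet (v, i) ∩ S ⊆
      insert (v, k) ((fun u => (u, i)) '' (G.neighborSet v ∩ boxLayer S i)) := by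
    rintro ⟨u, x⟩ ⟨hu, hxS⟩
    rw [mem_neighborSet, boxProd_adj] at hu
    rcases hu with ⟨hu, rfl⟩ | ⟨hu, rfl⟩
    · exact Or.inr ⟨u, ⟨hu, hxS⟩, rfl⟩
    · rcases hi x hu with rfl | rfl
      · exact absurd hxS hvj
      · exact Or.inl rfl
  have h2 : insert (v, j) ((fun u => (u, i)) '' (G.neighborSet v \ boxLayer S i)) ⊆
      (G.boxProd H).neighborSet (v, i) \ S := by
    rintro _ (rfl | ⟨u, ⟨hu, huS⟩, rfl⟩)
    · exact ⟨boxProd_adj.2 (Or.inr ⟨hij, rfl⟩), hvj⟩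
    · exact ⟨boxProd_adj.2 (Or.inl ⟨hu, rfl⟩), huS⟩
  have h3 := (Set.ncard_le_ncard h1).trans (Set.ncard_insert_le _ _)
  have h4 := Set.ncard_le_ncard h2
  have hv : (v, j) ∉ (fun u => (u, i)) '' (G.neighborSet v \ boxLayer S i) := by
    rintro ⟨u, -, hu⟩
    exact hij.ne (Prod.ext_iff.1 hu).2
  rw [Set.ncard_insert_of_notMem hv, Set.ncard_image_of_injective _ inj] at h4
  rw [Set.ncard_image_of_injective _ inj] at h3
  omega

/-- A layer over a vertex with neighbors `j` and `k`, together with the intersection of the layers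
over `j` and `k`, is a global offensive alliance of the first factor. -/
theorem IsGlobalOffensiveAlliance.boxLayer_union {V W : Type*} [Finite V] [Finite W]
    {G : SimpleGraph V} {H : SimpleGraph W} {S : Set (V × W)}
    (hS : IsGlobalOffensiveAlliance (G.boxProd H) S) {i j k : W}
    (hi : ∀ x, H.Adj i x ↔ x = j ∨ x = k) :
    IsGlobalOffensiveAlliance G (boxLayer S i ∪ (boxLayer S j ∩ boxLayer S k)) := by
  intro v hv
  simp only [Set.mem_union, Set.mem_inter_iff, not_or, not_and_or] at hv
  have key : (G.neighborSet v \ boxLayer S i).ncard + 1 ≤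
      (G.neighborSet v ∩ boxLayer S i).ncard := by
    rcases hv with ⟨hvi, hvj | hvk⟩
    · exact hS.ncard_boxLayer_le ((hi j).2 (Or.inl rfl)) (fun x => (hi x).1) hvi hvj
    · exact hS.ncard_boxLayer_le ((hi k).2 (Or.inr rfl)) (fun x hx => ((hi x).1 hx).symm)
        hvi hvk
  calc _ ≤ (G.neighborSet v \ boxLayer S i).ncard + 1 :=
        Nat.succ_le_succ (Set.ncard_le_ncard (Set.sdiff_subset_sdiff_right Set.subset_union_left))
    _ ≤ _ := key
    _ ≤ _ := Set.ncard_le_ncard (Set.inter_subset_inter_right _ Set.subset_union_left)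

theorem stmt6 {V : Type*} [Fintype V] [Nonempty V] (G : SimpleGraph V)
    (hG : ∀ v : V, ∃ u : V, G.Adj v u) (n : ℕ) (hn : 3 ≤ n) :
    globalOffensiveAllianceNumber (G.boxProd (cycleGraph n)) ≥
      (n * globalOffensiveAllianceNumber G + 1) / 2 := by
  obtain ⟨m, rfl⟩ : ∃ m, n = m + 2 := ⟨n - 2, by omega⟩
  obtain ⟨S, hS, hcard⟩ :=
    exists_isGlobalOffensiveAlliance_ncard_eq (G.boxProd (cycleGraph (m + 2)))
  have hadj (i x : Fin (m + 2)) : (cycleGraph (m + 2)).Adj i x ↔ x = i - 1 ∨ x = i + 1 := by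
    rw [← mem_neighborSet, cycleGraph_neighborSet]
    simp
  have hle (i : Fin (m + 2)) : globalOffensiveAllianceNumber G ≤
      (boxLayer S i).ncard + (boxLayer S (i + 1)).ncard :=
    calc _ ≤ _ := globalOffensiveAllianceNumber_le_ncard (hS.boxLayer_union (hadj i))
      _ ≤ _ := Set.ncard_union_le _ _
      _ ≤ _ := Nat.add_le_add_left (Set.ncard_le_ncard Set.inter_subset_right) _
  have hsum := Finset.sum_le_sum fun i (_ : i ∈ Finset.univ) => hle i
  have hshift : ∑ i : Fin (m + 2), (boxLayer S (i + 1)).ncard = ∑ i, (boxLayer S i).ncard :=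
    Equiv.sum_comp (Equiv.addRight 1) fun i => (boxLayer S i).ncard
  rw [Finset.sum_add_distrib, hshift, ← ncard_eq_sum_ncard_boxLayer, Finset.sum_const,
    Finset.card_univ, Fintype.card_fin, smul_eq_mul, hcard] at hsum
  omega
end

section
/- For all integers r ≥ 2 and t ≥ 2, the global offensive alliance number of the bamboo graph K_r □ P_t is γo(K_r □ P_t) = ⌊r·t/2⌋, where K_r is the complete graph on r vertices and P_t is the path graph on t vertices. -/
open SimpleGraph

theorem boxProd_neighborSet_inter_ncard {V W : Type*} [Finite V] [Finite W]
    (G : SimpleGraph V) (H : SimpleGraph W) (S : Set (V × W)) (a : V) (i : W) :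
    ((G.boxProd H).neighborSet (a, i) ∩ S).ncard =
      (G.neighborSet a ∩ {b | (b, i) ∈ S}).ncard +
        (H.neighborSet i ∩ {j | (a, j) ∈ S}).ncard := by
  have hunion : (G.boxProd H).neighborSet (a, i) ∩ S =
      (fun b => (b, i)) '' (G.neighborSet a ∩ {b | (b, i) ∈ S}) ∪
        (fun j => (a, j)) '' (H.neighborSet i ∩ {j | (a, j) ∈ S}) := by
    ext ⟨b, j⟩
    simp only [Set.mem_inter_iff, mem_neighborSet, boxProd_adj, Set.mem_union, Set.mem_image,
      Set.mem_ofPred_eq, Prod.mk.injEq]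
    grind
  rw [hunion, Set.ncard_union_eq, Set.ncard_image_of_injective _ (Prod.mk_left_injective i),
    Set.ncard_image_of_injective _ (Prod.mk_right_injective a)]
  rw [Set.disjoint_left]
  rintro _ ⟨b, ⟨hb, -⟩, rfl⟩ ⟨j, ⟨hj, -⟩, h⟩
  have hab : a = b := (Prod.ext_iff.1 h).1
  exact G.ne_of_adj hb hab

theorem isGlobalOffensiveAlliance_complete_boxProd_iff {V W : Type*} [Finite V] [Finite W]
    (H : SimpleGraph W) (S : Set (V × W)) :
    IsGlobalOffensiveAlliance ((⊤ : SimpleGraph V).boxProd H) S ↔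
      ∀ a i, (a, i) ∉ S →
        {b | (b, i) ∈ S}ᶜ.ncard + (H.neighborSet i \ {j | (a, j) ∈ S}).ncard ≤
          {b | (b, i) ∈ S}.ncard + (H.neighborSet i ∩ {j | (a, j) ∈ S}).ncard := by
  rw [IsGlobalOffensiveAlliance, Prod.forall]
  refine forall_congr' fun a => forall_congr' fun i => forall_congr' fun h => ?_
  have hin : (⊤ : SimpleGraph V).neighborSet a ∩ {b | (b, i) ∈ S} = {b | (b, i) ∈ S} := by
    ext b
    simp only [Set.mem_inter_iff, mem_neighborSet, top_adj, Set.mem_ofPred_eq]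
    grind
  have hout : (⊤ : SimpleGraph V).neighborSet a ∩ {b | (b, i) ∈ Sᶜ} =
      {b | (b, i) ∈ S}ᶜ \ {a} := by
    ext b
    simp only [Set.mem_inter_iff, mem_neighborSet, top_adj, Set.mem_ofPred_eq, Set.mem_sdiff,
      Set.mem_compl_iff, Set.mem_singleton_iff]
    grind
  have hcard := Set.ncard_sdiff_singleton_add_one
    (show a ∈ {b | (b, i) ∈ S}ᶜ from h) (Set.toFinite _)
  have hcompl : {j | (a, j) ∈ Sᶜ} = {j | (a, j) ∈ S}ᶜ := rfl
  rw [Set.sdiff_eq (_ : Set (V × W)), boxProd_neighborSet_inter_ncard,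
    boxProd_neighborSet_inter_ncard, hin, hout, hcompl, ← Set.sdiff_eq]
  omega

theorem ncard_eq_sum_layers {V W : Type*} [Finite V] [Fintype W] (S : Set (V × W)) :
    S.ncard = ∑ i, {b | (b, i) ∈ S}.ncard := by
  let e : S ≃ Σ i, {b | (b, i) ∈ S} :=
    { toFun := fun x => ⟨x.1.2, x.1.1, x.2⟩
      invFun := fun y => ⟨(y.2.1, y.1), y.2.2⟩
      left_inv := fun _ => rfl
      right_inv := fun _ => rfl }
  rw [← Nat.card_coe_set_eq, Nat.card_congr e, Nat.card_sigma]
  simp only [Nat.card_coe_set_eq]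

theorem min_zero_le_sum_range (d : ℕ → ℤ) (n : ℕ)
    (h : ∀ i < n, d i < 0 → 0 ≤ d i + d (i + 1)) :
    min 0 (d n) ≤ ∑ i ∈ Finset.range (n + 1), d i := by
  induction n with
  | zero => simp
  | succ n ih =>
    have ih := ih fun i hi => h i (by omega)
    have := h n (by omega)
    rw [Finset.sum_range_succ]
    omega

/-- The set meeting even layers in the first `r / 2` vertices, and odd layers in the others. -/
def alternatingHalves (r t : ℕ) : Set (Fin r × Fin t) :=
  {v | v.1.val < r / 2 ↔ Even v.2.val}

theorem ncard_alternatingHalves_layer (r t : ℕ) (i : Fin t) :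
    {b | (b, i) ∈ alternatingHalves r t}.ncard = if Even i.val then r / 2 else r - r / 2 := by
  have hlow : {b : Fin r | b.val < r / 2}.ncard = r / 2 := by
    rw [Set.ncard_eq_toFinset_card', Set.toFinset_ofPred, Fin.card_filter_val_lt]
    omega
  split_ifs with hi
  · simpa [alternatingHalves, hi] using hlow
  · have hcompl : {b | (b, i) ∈ alternatingHalves r t} = {b : Fin r | b.val < r / 2}ᶜ := by
      ext b
      simp [alternatingHalves, hi]
    rw [hcompl, Set.ncard_compl, hlow, Nat.card_eq_fintype_card, Fintype.card_fin]

theorem ncard_alternatingHalves (r t : ℕ) : (alternatingHalves r t).ncard = r * t / 2 := by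
  rw [ncard_eq_sum_layers]
  simp only [ncard_alternatingHalves_layer]
  rw [Fin.sum_univ_eq_sum_range (fun i => if Even i then r / 2 else r - r / 2) t]
  have hpair : ∀ t, (∑ i ∈ Finset.range t, if Even i then r / 2 else r - r / 2) = r * t / 2 ∧
      (∑ i ∈ Finset.range (t + 1), if Even i then r / 2 else r - r / 2) = r * (t + 1) / 2 := by
    intro t
    induction t with
    | zero => simp
    | succ t ih =>
      refine ⟨ih.2, ?_⟩
      rw [Finset.sum_range_succ, Finset.sum_range_succ, ih.1]
      have h2 : r * (t + 1 + 1) = r * t + 2 * r := by ring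
      rw [h2]
      by_cases h : Even t <;> simp only [h, Nat.even_add_one, not_true, not_false_iff, if_true,
        if_false] <;> omega
  exact (hpair t).1

theorem isGlobalOffensiveAlliance_alternatingHalves (r t : ℕ) (ht : 2 ≤ t) :
    IsGlobalOffensiveAlliance ((⊤ : SimpleGraph (Fin r)).boxProd (pathGraph t))
      (alternatingHalves r t) := by
  rw [isGlobalOffensiveAlliance_complete_boxProd_iff]
  intro a i h
  have hsub : (pathGraph t).neighborSet i ⊆ {j | (a, j) ∈ alternatingHalves r t} := by
    intro j hj
    rw [mem_neighborSet, pathGraph_adj] at hj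
    simp only [alternatingHalves, Set.mem_ofPred_eq] at h ⊢
    grind
  have hpos : 0 < ((pathGraph t).neighborSet i).ncard := by
    rw [Set.ncard_pos]
    by_cases hi : i.val + 1 < t
    · exact ⟨⟨i + 1, hi⟩, by simp [pathGraph_adj]⟩
    · exact ⟨⟨i - 1, by omega⟩, by simp [pathGraph_adj]; omega⟩
  rw [Set.inter_eq_left.2 hsub, Set.sdiff_eq_empty.2 hsub, Set.ncard_empty, Set.ncard_compl,
    Nat.card_eq_fintype_card, Fintype.card_fin, ncard_alternatingHalves_layer]
  split_ifs <;> omega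

section LowerBound

variable {r t : ℕ} {S : Set (Fin r × Fin t)}

theorem IsGlobalOffensiveAlliance.compl_layer_le_next
    (hS : IsGlobalOffensiveAlliance ((⊤ : SimpleGraph (Fin r)).boxProd (pathGraph t)) S)
    {i j : Fin t} (hij : i.val + 1 = j.val)
    (hi : {b | (b, i) ∈ S}.ncard < {b | (b, i) ∈ S}ᶜ.ncard) :
    {b | (b, i) ∈ S}ᶜ.ncard ≤ {b | (b, j) ∈ S}.ncard := by
  rw [isGlobalOffensiveAlliance_complete_boxProd_iff] at hS
  refine Set.ncard_le_ncard fun a ha => ?_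
  by_contra haj
  have hle := hS a i ha
  have hout : 0 < ((pathGraph t).neighborSet i \ {j | (a, j) ∈ S}).ncard := by
    rw [Set.ncard_pos]
    exact ⟨j, by simp [pathGraph_adj, hij], haj⟩
  have hin : ((pathGraph t).neighborSet i ∩ {j | (a, j) ∈ S}).ncard ≤ 1 := by
    rw [Set.ncard_le_one]
    rintro x ⟨hx, hxS⟩ y ⟨hy, hyS⟩
    rw [mem_neighborSet, pathGraph_adj] at hx hy
    have hxj : x ≠ j := by rintro rfl; exact haj hxS
    have hyj : y ≠ j := by rintro rfl; exact haj hyS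
    omega
  omega

theorem IsGlobalOffensiveAlliance.compl_last_layer_le
    (hS : IsGlobalOffensiveAlliance ((⊤ : SimpleGraph (Fin r)).boxProd (pathGraph t)) S)
    {i : Fin t} (hi : i.val + 1 = t) :
    {b | (b, i) ∈ S}ᶜ.ncard ≤ {b | (b, i) ∈ S}.ncard + 1 := by
  rw [isGlobalOffensiveAlliance_complete_boxProd_iff] at hS
  obtain hempty | ⟨a, ha⟩ := {b | (b, i) ∈ S}ᶜ.eq_empty_or_nonempty
  · simp [hempty]
  have hle := hS a i ha
  have hin : ((pathGraph t).neighborSet i ∩ {j | (a, j) ∈ S}).ncard ≤ 1 := by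
    rw [Set.ncard_le_one]
    rintro x ⟨hx, -⟩ y ⟨hy, -⟩
    rw [mem_neighborSet, pathGraph_adj] at hx hy
    omega
  omega

theorem IsGlobalOffensiveAlliance.le_ncard
    (hS : IsGlobalOffensiveAlliance ((⊤ : SimpleGraph (Fin r)).boxProd (pathGraph t)) S) :
    r * t / 2 ≤ S.ncard := by
  obtain _ | n := t
  · simp
  let c : ℕ → ℕ := fun k => {b | (b, Fin.ofNat (n + 1) k) ∈ S}.ncard
  have hval : ∀ k ≤ n, (Fin.ofNat (n + 1) k).val = k := fun k hk =>
    Nat.mod_eq_of_lt (by omega)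
  have hcompl : ∀ k, {b | (b, Fin.ofNat (n + 1) k) ∈ S}ᶜ.ncard + c k = r := fun k => by
    rw [add_comm, Set.ncard_add_ncard_compl, Nat.card_eq_fintype_card, Fintype.card_fin]
  have hnext : ∀ k < n, (2 * c k - r : ℤ) < 0 →
      0 ≤ (2 * c k - r : ℤ) + (2 * c (k + 1) - r : ℤ) := by
    intro k hk hneg
    have := hcompl k
    have hle := hS.compl_layer_le_next (i := Fin.ofNat (n + 1) k) (j := Fin.ofNat (n + 1) (k + 1))
      (by rw [hval k hk.le, hval (k + 1) hk]) (by change c k < _; omega)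
    change _ ≤ c (k + 1) at hle
    omega
  have hlast : {b | (b, Fin.ofNat (n + 1) n) ∈ S}ᶜ.ncard ≤ c n + 1 :=
    hS.compl_last_layer_le (by rw [hval n le_rfl])
  have hsum := min_zero_le_sum_range (fun k => 2 * c k - r) n hnext
  have hS_card : S.ncard = ∑ k ∈ Finset.range (n + 1), c k := by
    rw [ncard_eq_sum_layers, ← Fin.sum_univ_eq_sum_range]
    simp [c]
  rw [Finset.sum_sub_distrib, ← Finset.mul_sum, ← Nat.cast_sum, ← hS_card, Finset.sum_const,
    Finset.card_range, nsmul_eq_mul, mul_comm, ← Nat.cast_mul, mul_comm (n + 1)] at hsum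
  have := hcompl n
  omega

end LowerBound

theorem stmt11 (r t : ℕ) (hr : 2 ≤ r) (ht : 2 ≤ t) :
    globalOffensiveAllianceNumber ((⊤ : SimpleGraph (Fin r)).boxProd (pathGraph t)) =
      r * t / 2 := by
  have hmem := isGlobalOffensiveAlliance_alternatingHalves r t ht
  apply le_antisymm
  · exact Nat.sInf_le ⟨_, hmem, ncard_alternatingHalves r t⟩
  · refine le_csInf ⟨_, _, hmem, rfl⟩ ?_
    rintro _ ⟨S, hS, rfl⟩
    exact hS.le_ncard
end

section
/- For all integers r ≥ 3 and t ≥ 3, the global offensive alliance number of the torus graph C_r □ C_t is γo(C_r □ C_t) = ⌈r·t/2⌉, where C_n denotes the cycle graph on n vertices. -/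
open SimpleGraph

theorem cycleGraph_boxProd_neighborSet {m n : ℕ} (p : Fin (m + 3) × Fin (n + 3)) :
    ((cycleGraph (m + 3)).boxProd (cycleGraph (n + 3))).neighborSet p =
      {(p.1 - 1, p.2), (p.1 + 1, p.2), (p.1, p.2 - 1), (p.1, p.2 + 1)} := by
  rw [neighborSet_boxProd, cycleGraph_neighborSet, cycleGraph_neighborSet]
  ext ⟨a, b⟩
  simp only [Set.mem_union, Set.mem_prod, Set.mem_insert_iff, Set.mem_singleton_iff,
    Prod.mk.injEq]
  tauto

theorem Fin.sub_one_ne_add_one {n : ℕ} (a : Fin (n + 3)) : a - 1 ≠ a + 1 := by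
  intro h
  rw [sub_eq_iff_eq_add, add_assoc, left_eq_add, Fin.ext_iff] at h
  simp [Fin.val_add, Nat.mod_eq_of_lt] at h

theorem ncard_cycleGraph_boxProd_neighborSet {m n : ℕ} (p : Fin (m + 3) × Fin (n + 3)) :
    (((cycleGraph (m + 3)).boxProd (cycleGraph (n + 3))).neighborSet p).ncard = 4 := by
  obtain ⟨a, b⟩ := p
  have ha := Fin.sub_one_ne_add_one a
  have hb := Fin.sub_one_ne_add_one b
  rw [cycleGraph_boxProd_neighborSet, Set.ncard_insert_of_notMem, Set.ncard_insert_of_notMem,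
    Set.ncard_pair]
  all_goals simp [ha, hb]

/-- On a torus graph, a global offensive alliance is a set whose complement induces a subgraph
of maximum degree at most one. -/
theorem isGlobalOffensiveAlliance_torus_iff {m n : ℕ} (S : Set (Fin (m + 3) × Fin (n + 3))) :
    IsGlobalOffensiveAlliance ((cycleGraph (m + 3)).boxProd (cycleGraph (n + 3))) S ↔
      ∀ v ∉ S, (((cycleGraph (m + 3)).boxProd (cycleGraph (n + 3))).neighborSet v \ S).ncard
        ≤ 1 := by
  refine forall₂_congr fun v _ => ?_
  have h := Set.ncard_inter_add_ncard_sdiff_eq_ncard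
    (((cycleGraph (m + 3)).boxProd (cycleGraph (n + 3))).neighborSet v) S (Set.toFinite _)
  rw [ncard_cycleGraph_boxProd_neighborSet] at h
  omega

theorem mul_le_two_mul_ncard_of_isGlobalOffensiveAlliance {m n : ℕ}
    {S : Set (Fin (m + 3) × Fin (n + 3))}
    (hS : IsGlobalOffensiveAlliance ((cycleGraph (m + 3)).boxProd (cycleGraph (n + 3))) S) :
    (m + 3) * (n + 3) ≤ 2 * S.ncard := by
  classical
  rw [isGlobalOffensiveAlliance_torus_iff] at hS
  have key : ∀ v ∉ S, ∀ x y,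
      x ∈ ((cycleGraph (m + 3)).boxProd (cycleGraph (n + 3))).neighborSet v →
      y ∈ ((cycleGraph (m + 3)).boxProd (cycleGraph (n + 3))).neighborSet v →
      x ≠ y → x ∈ S ∨ y ∈ S := by
    intro v hv x y hx hy hxy
    by_contra! h
    exact hxy ((Set.ncard_le_one (Set.toFinite _)).1 (hS v hv) x ⟨hx, h.1⟩ y ⟨hy, h.2⟩)
  simp only [cycleGraph_boxProd_neighborSet, Set.mem_insert_iff, Set.mem_singleton_iff] at key
  let f : Fin (m + 3) × Fin (n + 3) → ℕ := fun p => if p ∈ S then 1 else 0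
  have square : ∀ p : Fin (m + 3) × Fin (n + 3),
      2 ≤ f p + f (p + (1, 0)) + f (p + (0, 1)) + f (p + (1, 1)) := by
    rintro ⟨a, b⟩
    have h1 := fun h => key (a, b) h (a + 1, b) (a, b + 1) (by simp) (by simp) (by simp)
    have h2 := fun h => key (a + 1, b) h (a, b) (a + 1, b + 1) (by simp) (by simp) (by simp)
    have h3 := fun h => key (a, b + 1) h (a, b) (a + 1, b + 1) (by simp) (by simp) (by simp)
    have h4 := fun h => key (a + 1, b + 1) h (a + 1, b) (a, b + 1) (by simp) (by simp) (by simp)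
    simp only [f, Prod.mk_add_mk, add_zero]
    split_ifs <;> first | omega | (exfalso; tauto)
  have shift : ∀ c, ∑ p, f (p + c) = ∑ p, f p := fun c => Equiv.sum_comp (Equiv.addRight c) f
  have total : ∑ p, f p = S.ncard := by
    rw [Finset.sum_boole, Set.ncard_eq_toFinset_card']
    simp [Set.toFinset]
  have h := Finset.sum_le_sum fun p (_ : p ∈ Finset.univ) => square p
  simp only [Finset.sum_add_distrib, shift, total, Finset.sum_const, Finset.card_univ,
    Fintype.card_prod, Fintype.card_fin, smul_eq_mul] at h
  omega

theorem sum_range_even_add (i n : ℕ) :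
    (∑ j ∈ Finset.range n, if Even (i + j) then 1 else 0) =
      if Even i then (n + 1) / 2 else n / 2 := by
  induction n with
  | zero => simp
  | succ n ih =>
    rw [Finset.sum_range_succ, ih]
    simp only [Nat.even_iff]
    split_ifs <;> omega

theorem sum_range_ite_even (m a b : ℕ) :
    (∑ i ∈ Finset.range m, if Even i then a else b) = (m + 1) / 2 * a + m / 2 * b := by
  induction m with
  | zero => simp
  | succ m ih =>
    rw [Finset.sum_range_succ, ih]
    obtain ⟨k, rfl | rfl⟩ := m.even_or_odd'
    · rw [if_pos (by simp), show (2 * k + 1 + 1) / 2 = k + 1 by omega,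
        show (2 * k + 1) / 2 = k by omega, show 2 * k / 2 = k by omega]
      ring
    · rw [if_neg (by simp), show (2 * k + 1 + 1 + 1) / 2 = k + 1 by omega,
        show (2 * k + 1 + 1) / 2 = k + 1 by omega, show (2 * k + 1) / 2 = k by omega]
      ring

theorem ncard_even_add (m n : ℕ) :
    {p : Fin m × Fin n | Even (p.1.val + p.2.val)}.ncard = (m * n + 1) / 2 := by
  rw [Set.ncard_eq_toFinset_card', Set.toFinset_ofPred, Finset.card_filter,
    Fintype.sum_prod_type]
  simp only
  rw [Fin.sum_univ_eq_sum_range (fun i => ∑ j : Fin n, if Even (i + j.val) then 1 else 0) m]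
  have h (i : ℕ) : (∑ j : Fin n, if Even (i + j.val) then 1 else 0) =
      if Even i then (n + 1) / 2 else n / 2 := by
    rw [Fin.sum_univ_eq_sum_range (fun j => if Even (i + j) then 1 else 0) n,
      sum_range_even_add]
  simp only [h]
  rw [sum_range_ite_even]
  obtain ⟨k, rfl | rfl⟩ := m.even_or_odd' <;> obtain ⟨l, rfl | rfl⟩ := n.even_or_odd'
  · rw [show (2 * k + 1) / 2 = k by omega, show 2 * k / 2 = k by omega,
      show (2 * l + 1) / 2 = l by omega, show 2 * l / 2 = l by omega,
      show 2 * k * (2 * l) + 1 = 2 * (2 * (k * l)) + 1 by ring]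
    have : k * l + k * l = 2 * (k * l) := by ring
    omega
  · rw [show (2 * k + 1) / 2 = k by omega, show 2 * k / 2 = k by omega,
      show (2 * l + 1 + 1) / 2 = l + 1 by omega, show (2 * l + 1) / 2 = l by omega,
      show 2 * k * (2 * l + 1) + 1 = 2 * (k * (l + 1) + k * l) + 1 by ring]
    omega
  · rw [show (2 * k + 1 + 1) / 2 = k + 1 by omega, show (2 * k + 1) / 2 = k by omega,
      show (2 * l + 1) / 2 = l by omega, show 2 * l / 2 = l by omega,
      show (2 * k + 1) * (2 * l) + 1 = 2 * ((k + 1) * l + k * l) + 1 by ring]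
    omega
  · rw [show (2 * k + 1 + 1) / 2 = k + 1 by omega, show (2 * k + 1) / 2 = k by omega,
      show (2 * l + 1 + 1) / 2 = l + 1 by omega, show (2 * l + 1) / 2 = l by omega,
      show (2 * k + 1) * (2 * l + 1) + 1 = 2 * ((k + 1) * (l + 1) + k * l) by ring]
    omega

theorem Fin.val_add_one_cases {n : ℕ} (a : Fin (n + 3)) :
    (a + 1).val = a.val + 1 ∨ a.val = n + 2 ∧ (a + 1).val = 0 := by
  rw [Fin.val_add_one]
  split_ifs with h
  · exact Or.inr ⟨by simp [h], rfl⟩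
  · exact Or.inl rfl

theorem Fin.val_sub_one_cases {n : ℕ} (a : Fin (n + 3)) :
    (a - 1).val + 1 = a.val ∨ a.val = 0 ∧ (a - 1).val = n + 2 := by
  have h := Fin.val_add_one_cases (a - 1)
  rw [sub_add_cancel] at h
  omega

theorem isGlobalOffensiveAlliance_even_add (m n : ℕ) :
    IsGlobalOffensiveAlliance ((cycleGraph (m + 3)).boxProd (cycleGraph (n + 3)))
      {p | Even (p.1.val + p.2.val)} := by
  rw [isGlobalOffensiveAlliance_torus_iff]
  rintro ⟨a, b⟩ hab
  rw [Set.ncard_le_one (Set.toFinite _), cycleGraph_boxProd_neighborSet]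
  have ha := Fin.val_add_one_cases a
  have ha' := Fin.val_sub_one_cases a
  have hb := Fin.val_add_one_cases b
  have hb' := Fin.val_sub_one_cases b
  simp only [Set.mem_ofPred_eq, Nat.even_iff] at hab
  rintro x ⟨hx, hxS⟩ y ⟨hy, hyS⟩
  simp only [Set.mem_insert_iff, Set.mem_singleton_iff] at hx hy
  simp only [Set.mem_ofPred_eq, Nat.even_iff] at hxS hyS
  rcases hx with rfl | rfl | rfl | rfl <;> rcases hy with rfl | rfl | rfl | rfl <;>
    first | rfl | (exfalso; dsimp only at hxS hyS; omega)

theorem stmt15 (r t : ℕ) (hr : 3 ≤ r) (ht : 3 ≤ t) :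
    globalOffensiveAllianceNumber ((cycleGraph r).boxProd (cycleGraph t)) =
      (r * t + 1) / 2 := by
  obtain ⟨m, rfl⟩ := Nat.exists_eq_add_of_le' hr
  obtain ⟨n, rfl⟩ := Nat.exists_eq_add_of_le' ht
  have hmem : ((m + 3) * (n + 3) + 1) / 2 ∈ {k | ∃ S : Set (Fin (m + 3) × Fin (n + 3)),
      IsGlobalOffensiveAlliance ((cycleGraph (m + 3)).boxProd (cycleGraph (n + 3))) S ∧
        S.ncard = k} :=
    ⟨_, isGlobalOffensiveAlliance_even_add m n, ncard_even_add _ _⟩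
  refine le_antisymm (Nat.sInf_le hmem) (le_csInf ⟨_, hmem⟩ ?_)
  rintro _ ⟨S, hS, rfl⟩
  have := mul_le_two_mul_ncard_of_isGlobalOffensiveAlliance hS
  omega
end

section
/- For all integers r ≥ 2 and t ≥ 3, the global offensive alliance number of the graph K_r □ C_t is γo(K_r □ C_t) = ⌈r·t/2⌉, where K_r is the complete graph on r vertices and C_t is the cycle graph on t vertices. -/
open SimpleGraph

open Classical in
/-- The number of vertices of `S` in the `j`-th copy of the first factor. -/
noncomputable def fiberCard {r t : ℕ} (S : Set (Fin r × Fin t)) (j : Fin t) : ℕ :=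
  (Finset.univ.filter fun i : Fin r => (i, j) ∈ S).card

theorem ncard_eq_sum_fiberCard {r t : ℕ} (S : Set (Fin r × Fin t)) :
    S.ncard = ∑ j, fiberCard S j := by
  classical
  have h : S = ((Finset.univ.filter fun x => x ∈ S : Finset (Fin r × Fin t)) : Set _) := by
    ext; simp
  conv_lhs => rw [h]
  rw [Set.ncard_coe_finset, Finset.card_filter, Fintype.sum_prod_type_right]
  exact Finset.sum_congr rfl fun j _ => (Finset.card_filter _ _).symm

theorem ncard_neighborSet_boxProd_cycleGraph {r n : ℕ} (v : Fin r × Fin (n + 3)) :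
    (((⊤ : SimpleGraph (Fin r)).boxProd (cycleGraph (n + 3))).neighborSet v).ncard = r + 1 := by
  classical
  rw [← Nat.card_coe_set_eq, Nat.card_eq_fintype_card, card_neighborSet_eq_degree,
    degree_boxProd, cycleGraph_degree_three_le, complete_graph_degree]
  have := v.1.pos
  simp only [Fintype.card_fin]
  omega

theorem Fin.add_one_ne_sub_one {n : ℕ} (j : Fin (n + 3)) : j + 1 ≠ j - 1 := by
  intro h
  have h2 : (1 + 1 : Fin (n + 3)) = 0 := by
    rw [← sub_eq_zero.2 h]
    abel
  have := congrArg Fin.val h2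
  simp only [Fin.val_add, Fin.val_one, Fin.val_zero] at this
  rw [Nat.mod_eq_of_lt (by omega)] at this
  omega

open Classical in
theorem ncard_neighborSet_inter {r n : ℕ} (S : Set (Fin r × Fin (n + 3))) (i : Fin r)
    (j : Fin (n + 3)) (h : (i, j) ∉ S) :
    (((⊤ : SimpleGraph (Fin r)).boxProd (cycleGraph (n + 3))).neighborSet (i, j) ∩ S).ncard =
      fiberCard S j + (if (i, j + 1) ∈ S then 1 else 0) + (if (i, j - 1) ∈ S then 1 else 0) := by
  have key : ((⊤ : SimpleGraph (Fin r)).boxProd (cycleGraph (n + 3))).neighborSet (i, j) ∩ S =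
      (((((Finset.univ.filter fun k : Fin r => (k, j) ∈ S).image fun k => (k, j)) ∪
        (if (i, j + 1) ∈ S then {(i, j + 1)} else ∅)) ∪
        (if (i, j - 1) ∈ S then {(i, j - 1)} else ∅) : Finset _) : Set _) := by
    ext ⟨a, b⟩
    have hb : (cycleGraph (n + 3)).Adj j b ↔ b = j + 1 ∨ b = j - 1 := by
      rw [← mem_neighborSet, cycleGraph_neighborSet]
      simp [or_comm]
    simp only [Set.mem_inter_iff, mem_neighborSet, boxProd_adj, top_adj, hb]
    split_ifs <;> simp <;> grind
  have hne := Fin.add_one_ne_sub_one j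
  rw [key, Set.ncard_coe_finset, Finset.card_union_of_disjoint, Finset.card_union_of_disjoint,
    Finset.card_image_of_injective _ fun a b hab => (Prod.mk.inj hab).1]
  · unfold fiberCard
    split_ifs <;> simp
  · rw [Finset.disjoint_left]
    split_ifs <;> simp
  · rw [Finset.disjoint_left]
    split_ifs <;> simp <;> grind

open Classical in
theorem isGlobalOffensiveAlliance_iff {r n : ℕ} (S : Set (Fin r × Fin (n + 3))) :
    IsGlobalOffensiveAlliance ((⊤ : SimpleGraph (Fin r)).boxProd (cycleGraph (n + 3))) S ↔
      ∀ i j, (i, j) ∉ S → r + 2 ≤ 2 * (fiberCard S j + (if (i, j + 1) ∈ S then 1 else 0) +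
        (if (i, j - 1) ∈ S then 1 else 0)) := by
  rw [IsGlobalOffensiveAlliance, Prod.forall]
  refine forall₃_congr fun i j h => ?_
  rw [← ncard_neighborSet_inter S i j h]
  have h1 := Set.ncard_inter_add_ncard_sdiff_eq_ncard
    (((⊤ : SimpleGraph (Fin r)).boxProd (cycleGraph (n + 3))).neighborSet (i, j)) S (Set.toFinite _)
  rw [ncard_neighborSet_boxProd_cycleGraph] at h1
  omega

theorem le_fiberCard_add {r t : ℕ} (S : Set (Fin r × Fin t)) (j k : Fin t)
    (h : ∀ i, (i, j) ∉ S → (i, k) ∈ S) : r ≤ fiberCard S j + fiberCard S k := by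
  classical
  unfold fiberCard
  refine le_trans ?_ (Finset.card_union_le _ _)
  rw [Finset.eq_univ_of_forall (s := _ ∪ _) (by grind), Finset.card_univ, Fintype.card_fin]

theorem le_two_mul_ncard {r n : ℕ} (S : Set (Fin r × Fin (n + 3)))
    (hS : IsGlobalOffensiveAlliance
      ((⊤ : SimpleGraph (Fin r)).boxProd (cycleGraph (n + 3))) S) :
    r * (n + 3) ≤ 2 * S.ncard := by
  classical
  rw [isGlobalOffensiveAlliance_iff] at hS
  have key (j : Fin (n + 3)) : r ≤ fiberCard S j + fiberCard S (j + 1) := by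
    by_cases h1 : 2 * fiberCard S j < r
    · exact le_fiberCard_add S _ _ fun i hi => by grind
    by_cases h2 : 2 * fiberCard S (j + 1) < r
    · rw [add_comm]
      refine le_fiberCard_add S _ _ fun i hi => ?_
      have := hS i (j + 1) hi
      rw [add_sub_cancel_right] at this
      grind
    omega
  have hsum := Finset.sum_le_sum fun j (_ : j ∈ Finset.univ) => key j
  rw [Finset.sum_add_distrib, show ∑ j, fiberCard S (j + 1) = ∑ j, fiberCard S j from
      Equiv.sum_comp (Equiv.addRight (1 : Fin (n + 3))) (fiberCard S),
    ← ncard_eq_sum_fiberCard] at hsum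
  simp only [Finset.sum_const, Finset.card_univ, Fintype.card_fin, smul_eq_mul] at hsum
  linarith

/-- The first `⌈r / 2⌉` vertices in the even copies of `K_r`, the remaining ones in the odd copies. -/
def alternatingSet (r t : ℕ) : Set (Fin r × Fin t) :=
  {x | x.1.val < (r + 1) / 2 ↔ x.2.val % 2 = 0}

theorem fiberCard_alternatingSet {r t : ℕ} (j : Fin t) :
    fiberCard (alternatingSet r t) j = if j.val % 2 = 0 then (r + 1) / 2 else r / 2 := by
  classical
  have h1 : (Finset.univ.filter fun i : Fin r => i.val < (r + 1) / 2).card = (r + 1) / 2 := by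
    rw [Fin.card_filter_val_lt]
    omega
  have h2 := Finset.card_filter_add_card_filter_not (s := (Finset.univ : Finset (Fin r)))
    (fun i : Fin r => i.val < (r + 1) / 2)
  rw [h1, Finset.card_univ, Fintype.card_fin] at h2
  unfold fiberCard alternatingSet
  split_ifs with h
  · simpa [h] using h1
  · simp only [Set.mem_ofPred_eq, h, iff_false]
    omega

theorem ncard_alternatingSet (r t : ℕ) : (alternatingSet r t).ncard = (r * t + 1) / 2 := by
  rw [ncard_eq_sum_fiberCard]
  simp only [fiberCard_alternatingSet]
  rw [Fin.sum_univ_eq_sum_range (fun j => if j % 2 = 0 then (r + 1) / 2 else r / 2)]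
  induction t using Nat.twoStepInduction with
  | zero => simp
  | one => simp
  | more t ih _ =>
    rw [Finset.sum_range_succ, Finset.sum_range_succ, ih, show r * (t + 2) = r * t + 2 * r by ring]
    split_ifs <;> omega

theorem isGlobalOffensiveAlliance_alternatingSet (r n : ℕ) :
    IsGlobalOffensiveAlliance ((⊤ : SimpleGraph (Fin r)).boxProd (cycleGraph (n + 3)))
      (alternatingSet r (n + 3)) := by
  classical
  rw [isGlobalOffensiveAlliance_iff]
  intro i j h
  have hadd : (j + 1).val = if j.val = n + 2 then 0 else j.val + 1 := by
    rw [Fin.val_add_one]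
    simp [Fin.ext_iff]
  have hsub : (j - 1).val = if j.val = 0 then n + 2 else j.val - 1 := by
    rw [Fin.coe_sub_one]
    simp only [Fin.ext_iff, Fin.val_zero]
  have hj := j.isLt
  rw [fiberCard_alternatingSet]
  simp only [alternatingSet, Set.mem_ofPred_eq, hadd, hsub] at h ⊢
  grind

theorem stmt16 (r t : ℕ) (hr : 2 ≤ r) (ht : 3 ≤ t) :
    globalOffensiveAllianceNumber ((⊤ : SimpleGraph (Fin r)).boxProd (cycleGraph t)) =
      (r * t + 1) / 2 := by
  obtain ⟨n, rfl⟩ := Nat.exists_eq_add_of_le' ht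
  have hmem := isGlobalOffensiveAlliance_alternatingSet r n
  refine IsLeast.csInf_eq ⟨⟨_, hmem, ncard_alternatingSet r (n + 3)⟩, ?_⟩
  rintro _ ⟨S, hS, rfl⟩
  have := le_two_mul_ncard S hS
  omega
end

section
/- Let r ≥ 2 and t ≥ 2 be even integers. Then the global offensive alliance number of the grid graph P_r □ P_t equals γo(P_r □ P_t) = r·t/2, where P_n denotes the path graph on n vertices. -/
open SimpleGraph

/-- A set containing every neighbor of each vertex outside it is a global offensive alliance,
provided those vertices are not isolated. -/
theorem isGlobalOffensiveAlliance_of_adj_mem {V : Type*} [Finite V] {G : SimpleGraph V}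
    {S : Set V} (hiso : ∀ v ∉ S, ∃ u, G.Adj v u) (hS : ∀ v ∉ S, ∀ u, G.Adj v u → u ∈ S) :
    IsGlobalOffensiveAlliance G S := by
  intro v hv
  have hout : G.neighborSet v \ S = ∅ := Set.sdiff_eq_empty.mpr fun u hu => hS v hv u hu
  obtain ⟨u, hu⟩ := hiso v hv
  have hin : 0 < (G.neighborSet v ∩ S).ncard :=
    (Set.ncard_pos (Set.toFinite _)).mpr ⟨u, hu, hS v hv u hu⟩
  rw [hout, Set.ncard_empty]
  omega

/-- If `v` has at most four neighbors, then out of `v` and any two of its neighbors, at least one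
belongs to a given global offensive alliance. -/
theorem IsGlobalOffensiveAlliance.mem_or_mem_or_mem {V : Type*} [Finite V] {G : SimpleGraph V}
    {S : Set V} (hS : IsGlobalOffensiveAlliance G S) {v u w : V}
    (hdeg : (G.neighborSet v).ncard ≤ 4) (hu : G.Adj v u) (hw : G.Adj v w) (huw : u ≠ w) :
    v ∈ S ∨ u ∈ S ∨ w ∈ S := by
  by_contra! ⟨hvS, huS, hwS⟩
  have hv := hS v hvS
  have hsum := Set.ncard_inter_add_ncard_sdiff_eq_ncard (G.neighborSet v) S (Set.toFinite _)
  have htwo : ({u, w} : Set V).ncard ≤ (G.neighborSet v \ S).ncard := by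
    refine Set.ncard_le_ncard ?_ (Set.toFinite _)
    rintro x (rfl | rfl)
    exacts [⟨hu, huS⟩, ⟨hw, hwS⟩]
  rw [Set.ncard_pair huw] at htwo
  omega

theorem boxProd_pathGraph_adj {r t : ℕ} (x y : Fin r × Fin t) :
    ((pathGraph r).boxProd (pathGraph t)).Adj x y ↔
      ((x.1.val + 1 = y.1.val ∨ y.1.val + 1 = x.1.val) ∧ x.2.val = y.2.val) ∨
      ((x.2.val + 1 = y.2.val ∨ y.2.val + 1 = x.2.val) ∧ x.1.val = y.1.val) := by
  simp only [boxProd_adj, pathGraph_adj, Fin.ext_iff]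

theorem ncard_neighborSet_boxProd_pathGraph_le {r t : ℕ} (x : Fin r × Fin t) :
    (((pathGraph r).boxProd (pathGraph t)).neighborSet x).ncard ≤ 4 := by
  let f : Fin r × Fin t → ℕ × ℕ := fun y => (y.1.val, y.2.val)
  have hf : Function.Injective f := fun y z h => by
    simpa [f, Prod.ext_iff, Fin.ext_iff] using h
  let N : Finset (ℕ × ℕ) := {(x.1.val + 1, x.2.val), (x.1.val - 1, x.2.val),
    (x.1.val, x.2.val + 1), (x.1.val, x.2.val - 1)}
  rw [← Set.ncard_image_of_injective _ hf]
  calc _ ≤ (N : Set (ℕ × ℕ)).ncard := by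
        refine Set.ncard_le_ncard ?_ N.finite_toSet
        rintro _ ⟨y, hy, rfl⟩
        rw [mem_neighborSet, boxProd_pathGraph_adj] at hy
        simp only [f, N, Finset.coe_insert, Finset.coe_singleton, Set.mem_insert_iff,
          Set.mem_singleton_iff, Prod.mk.injEq]
        omega
    _ ≤ 4 := by
        rw [Set.ncard_coe_finset]
        exact Finset.card_le_four

/-- A global offensive alliance of an even by even grid contains at least two vertices of each
`2 × 2` block, hence at least half of all vertices. -/
theorem IsGlobalOffensiveAlliance.two_mul_le_ncard {a b : ℕ}
    {S : Set (Fin (a + a) × Fin (b + b))}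
    (hS : IsGlobalOffensiveAlliance ((pathGraph (a + a)).boxProd (pathGraph (b + b))) S) :
    2 * (a * b) ≤ S.ncard := by
  classical
  let block : Fin (a + a) × Fin (b + b) → ℕ × ℕ := fun x => (x.1.val / 2, x.2.val / 2)
  have hmaps : ∀ x ∈ S.toFinset, block x ∈ Finset.range a ×ˢ Finset.range b := by
    intro x _
    simp only [block, Finset.mem_product, Finset.mem_range]
    omega
  rw [Set.ncard_eq_toFinset_card', Finset.card_eq_sum_card_fiberwise hmaps]
  have hblock : ∀ p ∈ Finset.range a ×ˢ Finset.range b,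
      2 ≤ (S.toFinset.filter fun x => block x = p).card := by
    rintro ⟨i, j⟩ hp
    simp only [Finset.mem_product, Finset.mem_range] at hp
    let i₀ : Fin (a + a) := ⟨2 * i, by omega⟩
    let i₁ : Fin (a + a) := ⟨2 * i + 1, by omega⟩
    let j₀ : Fin (b + b) := ⟨2 * j, by omega⟩
    let j₁ : Fin (b + b) := ⟨2 * j + 1, by omega⟩
    have key : ∀ v u w : Fin (a + a) × Fin (b + b),
        ((pathGraph (a + a)).boxProd (pathGraph (b + b))).Adj v u →
        ((pathGraph (a + a)).boxProd (pathGraph (b + b))).Adj v w → u ≠ w →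
        v ∈ S ∨ u ∈ S ∨ w ∈ S := fun v _ _ hu hw huw =>
      hS.mem_or_mem_or_mem (ncard_neighborSet_boxProd_pathGraph_le v) hu hw huw
    have h₀₀ := key (i₀, j₀) (i₀, j₁) (i₁, j₀)
      (by simp [pathGraph_adj, i₀, j₀, j₁]) (by simp [pathGraph_adj, i₀, i₁, j₀])
      (by simp [i₀, i₁])
    have h₁₁ := key (i₁, j₁) (i₀, j₁) (i₁, j₀)
      (by simp [pathGraph_adj, i₀, i₁, j₁]) (by simp [pathGraph_adj, i₁, j₀, j₁])
      (by simp [i₀, i₁])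
    have h₀₁ := key (i₀, j₁) (i₀, j₀) (i₁, j₁)
      (by simp [pathGraph_adj, i₀, j₀, j₁]) (by simp [pathGraph_adj, i₀, i₁, j₁])
      (by simp [i₀, i₁])
    have h₁₀ := key (i₁, j₀) (i₀, j₀) (i₁, j₁)
      (by simp [pathGraph_adj, i₀, i₁, j₀]) (by simp [pathGraph_adj, i₁, j₀, j₁])
      (by simp [i₀, i₁])
    have hi : i₀ ≠ i₁ := by simp [i₀, i₁]
    have hj : j₀ ≠ j₁ := by simp [j₀, j₁]
    have hb₀₀ : block (i₀, j₀) = (i, j) := by simp [block, i₀, j₀]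
    have hb₀₁ : block (i₀, j₁) = (i, j) := by simp [block, i₀, j₁]; omega
    have hb₁₀ : block (i₁, j₀) = (i, j) := by simp [block, i₁, j₀]; omega
    have hb₁₁ : block (i₁, j₁) = (i, j) := by simp [block, i₁, j₁]; omega
    rw [Nat.succ_le_iff, Finset.one_lt_card_iff]
    simp only [Finset.mem_filter, Set.mem_toFinset]
    clear_value i₀ i₁ j₀ j₁ block
    grind
  simpa [mul_comm] using Finset.sum_le_sum hblock

theorem exists_boxProd_pathGraph_adj {r t : ℕ} (hr : 2 ≤ r) (x : Fin r × Fin t) :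
    ∃ y, ((pathGraph r).boxProd (pathGraph t)).Adj x y := by
  by_cases h : x.1.val = 0
  · exact ⟨(⟨1, by omega⟩, x.2), by simp [pathGraph_adj, h]⟩
  · refine ⟨(⟨x.1.val - 1, by omega⟩, x.2), (boxProd_pathGraph_adj _ _).mpr ?_⟩
    exact Or.inl ⟨Or.inr (Nat.sub_add_cancel (by omega)), rfl⟩

theorem stmt17 (r t : ℕ) (hr : 2 ≤ r) (ht : 2 ≤ t) (hre : Even r) (hte : Even t) :
    globalOffensiveAllianceNumber ((pathGraph r).boxProd (pathGraph t)) = r * t / 2 := by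
  obtain ⟨a, rfl⟩ := hre
  obtain ⟨b, rfl⟩ := hte
  have hhalf : (a + a) * (b + b) / 2 = 2 * (a * b) := by
    rw [show (a + a) * (b + b) = 2 * (a * b) * 2 by ring, Nat.mul_div_cancel _ two_pos]
  rw [hhalf]
  let S : Set (Fin (a + a) × Fin (b + b)) := {x | (x.1.val + x.2.val) % 2 = 1}
  have hS : IsGlobalOffensiveAlliance ((pathGraph (a + a)).boxProd (pathGraph (b + b))) S := by
    refine isGlobalOffensiveAlliance_of_adj_mem
      (fun x _ => exists_boxProd_pathGraph_adj hr x) fun x hx y hxy => ?_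
    rw [boxProd_pathGraph_adj] at hxy
    simp only [S, Set.mem_ofPred_eq] at hx ⊢
    omega
  have hSc : IsGlobalOffensiveAlliance ((pathGraph (a + a)).boxProd (pathGraph (b + b))) Sᶜ := by
    refine isGlobalOffensiveAlliance_of_adj_mem
      (fun x _ => exists_boxProd_pathGraph_adj hr x) fun x hx y hxy => ?_
    rw [boxProd_pathGraph_adj] at hxy
    simp only [S, Set.mem_compl_iff, Set.mem_ofPred_eq] at hx ⊢
    omega
  have hcard : S.ncard = 2 * (a * b) := by
    have hsum := Set.ncard_add_ncard_compl S
    have htotal : Nat.card (Fin (a + a) × Fin (b + b)) = 2 * (2 * (a * b)) := by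
      rw [Nat.card_prod, Nat.card_fin, Nat.card_fin]
      ring
    have h₁ := hS.two_mul_le_ncard
    have h₂ := hSc.two_mul_le_ncard
    omega
  refine le_antisymm (Nat.sInf_le ⟨S, hS, hcard⟩) (le_csInf ⟨_, S, hS, hcard⟩ ?_)
  rintro _ ⟨T, hT, rfl⟩
  exact hT.two_mul_le_ncard
end

section
/- Let r ≥ 2 be an even integer and t ≥ 3 an odd integer. Then the global offensive alliance number of the grid graph P_r □ P_t equals γo(P_r □ P_t) = r·(t−1)/2 + ⌈r/3⌉, where P_n denotes the path graph on n vertices. -/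
open SimpleGraph

open Finset in
/-- If consecutive values sum to at most `2`, then an initial segment of odd length is bounded
in terms of any of its even-indexed entries. -/
theorem sum_range_le_of_consecutive_le (y : ℕ → ℕ) (m l : ℕ) (hl : l ≤ m)
    (h : ∀ j, j < 2 * m → y j + y (j + 1) ≤ 2) :
    ∑ j ∈ range (2 * m + 1), y j ≤ 2 * m + y (2 * l) := by
  have hpairs : ∀ n ≤ m, ∑ j ∈ range (2 * n), y j ≤ 2 * n := by
    intro n hn
    induction n with
    | zero => simp
    | succ n ih =>
      rw [show 2 * (n + 1) = 2 * n + 1 + 1 by ring, sum_range_succ, sum_range_succ]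
      have := ih (by omega)
      have := h (2 * n) (by omega)
      omega
  induction m with
  | zero =>
    obtain rfl : l = 0 := by omega
    simp
  | succ m ih =>
    rcases Nat.lt_or_ge m l with hml | hml
    · obtain rfl : l = m + 1 := by omega
      rw [sum_range_succ]
      have := hpairs (m + 1) le_rfl
      omega
    · have := ih hml (fun j hj => h j (by omega)) (fun n hn => hpairs n (by omega))
      rw [show 2 * (m + 1) + 1 = 2 * m + 1 + 1 + 1 by ring, sum_range_succ, sum_range_succ]
      have : y (2 * m + 1) + y (2 * m + 1 + 1) ≤ 2 := h (2 * m + 1) (by omega)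
      lia

open Finset in
/-- A sequence with nonzero ends, without consecutive zeros, and with an entry at least `2` between
any two zeros at distance two, has average at least `2 / 3`. -/
theorem two_mul_le_three_mul_sum_of_sparse_zeros (d : ℕ → ℕ) (k : ℕ)
    (h0 : d 0 ≠ 0) (hlast : d k ≠ 0)
    (hadj : ∀ i < k, d i = 0 → d (i + 1) ≠ 0)
    (hgap : ∀ i, i + 1 < k → d i = 0 → d (i + 2) = 0 → 2 ≤ d (i + 1)) :
    2 * (k + 1) ≤ 3 * ∑ i ∈ range (k + 1), d i := by
  have key : ∀ n, n ≤ k →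
      2 * n + 1 ≤ 3 * ∑ i ∈ range (n + 1), d i ∧
      (d n ≠ 0 → 2 * n + 2 ≤ 3 * ∑ i ∈ range (n + 1), d i) ∧
      (d n ≠ 0 → (∀ p, p + 1 = n → d p = 0 → 2 ≤ d n) →
        2 * n + 3 ≤ 3 * ∑ i ∈ range (n + 1), d i) := by
    intro n
    induction n with
    | zero => intro _; simp; omega
    | succ n ih =>
      intro hn
      obtain ⟨ha, hb, hc⟩ := ih (by omega)
      rw [sum_range_succ _ (n + 1)]
      have hadj' := hadj n (by omega)
      by_cases hz : d (n + 1) = 0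
      · have hn0 : d n ≠ 0 := fun h => hadj' h hz
        have := hc hn0 fun p hp hp0 => by
          subst hp
          exact hgap p (by omega) hp0 hz
        exact ⟨by omega, fun h => absurd hz h, fun h => absurd hz h⟩
      · by_cases hn0 : d n = 0
        · refine ⟨by omega, fun _ => by omega, fun _ h => ?_⟩
          have := h n rfl hn0
          omega
        · have := hb hn0
          exact ⟨by omega, fun _ => by omega, fun _ _ => by omega⟩
  have := (key k le_rfl).2.1 hlast
  omega

open Finset in
/-- An upper bound for the size of a `0`-`1` array with `2 * (k + 1)` rows and `2 * m + 1` columns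
in which the ones induce a matching that avoids the corners. -/
theorem sum_array_le_of_matching (x : ℕ → ℕ → ℕ) (k m : ℕ) (hx : ∀ i j, x i j ≤ 1)
    (hsq : ∀ i j, i < 2 * k + 1 → j < 2 * m →
      x i j + x i (j + 1) + x (i + 1) j + x (i + 1) (j + 1) ≤ 2)
    (hcol : ∀ i j, i < 2 * k → j < 2 * m + 1 → x i j + x (i + 1) j + x (i + 2) j ≤ 2)
    (htop : x 0 0 + x 1 0 ≤ 1) (hbot : x (2 * k) 0 + x (2 * k + 1) 0 ≤ 1) :
    (∑ i ∈ range (2 * (k + 1)), ∑ j ∈ range (2 * m + 1), x i j) + (2 * (k + 1) + 2) / 3 ≤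
      (k + 1) * (2 * m + 2) := by
  have hrows : ∀ n, ∑ i ∈ range (2 * n), ∑ j ∈ range (2 * m + 1), x i j =
      ∑ i ∈ range n, ∑ j ∈ range (2 * m + 1), (x (2 * i) j + x (2 * i + 1) j) := by
    intro n
    induction n with
    | zero => simp
    | succ n ih =>
      rw [show 2 * (n + 1) = 2 * n + 1 + 1 by ring, sum_range_succ, sum_range_succ, ih,
        sum_range_succ _ n, sum_add_distrib]
      ring
  set c : ℕ → ℕ := fun i => ∑ j ∈ range (2 * m + 1), (x (2 * i) j + x (2 * i + 1) j) with hc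
  have hstrip : ∀ i ≤ k, ∀ l ≤ m, c i ≤ 2 * m + (x (2 * i) (2 * l) + x (2 * i + 1) (2 * l)) := by
    intro i hi l hl
    refine sum_range_le_of_consecutive_le (fun j => x (2 * i) j + x (2 * i + 1) j) m l hl ?_
    intro j hj
    have := hsq (2 * i) j (by omega) hj
    omega
  have hc_le : ∀ i ≤ k, c i ≤ 2 * m + 2 := by
    intro i hi
    have := hstrip i hi 0 (Nat.zero_le _)
    have := hx (2 * i) (2 * 0)
    have := hx (2 * i + 1) (2 * 0)
    omega
  have hdef : 2 * (k + 1) ≤ 3 * ∑ i ∈ range (k + 1), (2 * m + 2 - c i) := by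
    apply two_mul_le_three_mul_sum_of_sparse_zeros
    · have := hstrip 0 (Nat.zero_le _) 0 (Nat.zero_le _)
      simp only [mul_zero, zero_add] at this
      omega
    · have := hstrip k le_rfl 0 (Nat.zero_le _)
      simp only [mul_zero] at this
      omega
    · intro i hi hi0
      have h1 := hstrip i hi.le 0 (Nat.zero_le _)
      have h2 := hstrip (i + 1) hi 0 (Nat.zero_le _)
      have h3 := hcol (2 * i) 0 (by omega) (by omega)
      have h4 := hx (2 * (i + 1) + 1) 0
      rw [mul_zero] at h1 h2
      rw [mul_add, mul_one] at h2 h4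
      omega
    · intro i hi hi0 hi2
      have hzero : ∀ l ≤ m, x (2 * (i + 1)) (2 * l) + x (2 * (i + 1) + 1) (2 * l) = 0 := by
        intro l hl
        have h1 := hstrip i (by omega) l hl
        have h2 := hstrip (i + 2) (by omega) l hl
        have h3 := hcol (2 * i) (2 * l) (by omega) (by omega)
        have h4 := hcol (2 * i + 3) (2 * l) (by omega) (by omega)
        have h5 := hx (2 * i) (2 * l)
        have h6 := hx (2 * i + 1) (2 * l)
        have h7 := hx (2 * i + 4) (2 * l)
        have h8 := hx (2 * i + 5) (2 * l)
        rw [show 2 * (i + 2) = 2 * i + 4 by ring] at h2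
        rw [show 2 * (i + 1) = 2 * i + 2 by ring]
        simp only [add_assoc, Nat.reduceAdd] at *
        omega
      have h1 := hstrip (i + 1) (by omega) 0 (Nat.zero_le _)
      have h2 := hzero 0 (Nat.zero_le _)
      omega
  have htotal : ∑ i ∈ range (k + 1), c i + ∑ i ∈ range (k + 1), (2 * m + 2 - c i) =
      (k + 1) * (2 * m + 2) := by
    rw [← sum_add_distrib, sum_congr rfl (g := fun _ => 2 * m + 2)]
    · simp
    · intro i hi
      have := hc_le i (by simpa [Nat.lt_succ_iff] using hi)
      omega
  rw [hrows]
  change ∑ i ∈ range (k + 1), c i + _ ≤ _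
  omega

open Finset in
theorem ncard_setOf_fin_prod (r t : ℕ) (P : ℕ → ℕ → Prop) [∀ i j, Decidable (P i j)] :
    {p : Fin r × Fin t | P p.1 p.2}.ncard =
      ∑ i ∈ range r, ∑ j ∈ range t, if P i j then 1 else 0 := by
  rw [← Fin.sum_univ_eq_sum_range (fun i => ∑ j ∈ range t, if P i j then 1 else 0)]
  simp_rw [← Fin.sum_univ_eq_sum_range (fun j => if P _ j then 1 else 0)]
  rw [← Fintype.sum_prod_type' (f := fun (i : Fin r) (j : Fin t) => if P i j then 1 else 0),
    ← card_filter, ← Set.ncard_coe_finset]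
  simp

theorem grid_adj_iff {r t : ℕ} (u v : Fin r × Fin t) :
    ((pathGraph r).boxProd (pathGraph t)).Adj u v ↔
      ((u.1.val + 1 = v.1.val ∨ v.1.val + 1 = u.1.val) ∧ u.2.val = v.2.val) ∨
      ((u.2.val + 1 = v.2.val ∨ v.2.val + 1 = u.2.val) ∧ u.1.val = v.1.val) := by
  rw [boxProd_adj, pathGraph_adj, pathGraph_adj, Fin.ext_iff, Fin.ext_iff]

theorem IsGlobalOffensiveAlliance.two_mul_card_lt {V : Type*} [Finite V] {G : SimpleGraph V}
    {S : Set V} (hS : IsGlobalOffensiveAlliance G S) {v : V} (hv : v ∉ S) {n : ℕ}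
    (hn : (G.neighborSet v).ncard ≤ n) (T : Finset V) (hT : ∀ u ∈ T, G.Adj v u ∧ u ∉ S) :
    2 * T.card + 1 ≤ n := by
  have h1 := hS v hv
  have h2 := Set.ncard_inter_add_ncard_sdiff_eq_ncard (G.neighborSet v) S (Set.toFinite _)
  have h3 : (T : Set V).ncard ≤ (G.neighborSet v \ S).ncard :=
    Set.ncard_le_ncard (fun u hu => hT u hu) (Set.toFinite _)
  rw [Set.ncard_coe_finset] at h3
  omega

theorem ncard_le_of_coe_mem {r t : ℕ} (N : Set (Fin r × Fin t)) (F : Finset (ℕ × ℕ))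
    (h : ∀ p ∈ N, (p.1.val, p.2.val) ∈ F) : N.ncard ≤ F.card := by
  rw [← Set.ncard_coe_finset]
  refine Set.ncard_le_ncard_of_injOn (fun p : Fin r × Fin t => (p.1.val, p.2.val)) h ?_
    F.finite_toSet
  rintro ⟨a, b⟩ - ⟨c, d⟩ - h
  simpa [Fin.ext_iff] using h

theorem grid_ncard_neighborSet_le {r t : ℕ} (v : Fin r × Fin t) :
    (((pathGraph r).boxProd (pathGraph t)).neighborSet v).ncard ≤ 4 := by
  obtain ⟨⟨a, ha⟩, ⟨b, hb⟩⟩ := v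
  refine (ncard_le_of_coe_mem _ {(a + 1, b), (a - 1, b), (a, b + 1), (a, b - 1)} ?_).trans
    Finset.card_le_four
  rintro ⟨⟨c, hc⟩, ⟨d, hd⟩⟩ h
  rw [mem_neighborSet, grid_adj_iff] at h
  simp only [Finset.mem_insert, Finset.mem_singleton, Prod.mk.injEq] at h ⊢
  omega

theorem grid_ncard_neighborSet_corner_le {r t : ℕ} (v : Fin r × Fin t)
    (h1 : v.1.val = 0 ∨ v.1.val + 1 = r) (h2 : v.2.val = 0) :
    (((pathGraph r).boxProd (pathGraph t)).neighborSet v).ncard ≤ 2 := by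
  obtain ⟨⟨a, ha⟩, ⟨b, hb⟩⟩ := v
  refine (ncard_le_of_coe_mem _ {(if a = 0 then 1 else a - 1, 0), (a, 1)} ?_).trans
    Finset.card_le_two
  rintro ⟨⟨c, hc⟩, ⟨d, hd⟩⟩ h
  rw [mem_neighborSet, grid_adj_iff] at h
  simp only [Finset.mem_insert, Finset.mem_singleton, Prod.mk.injEq] at h h1 h2 ⊢
  split_ifs <;> omega

open Finset in
theorem IsGlobalOffensiveAlliance.le_ncard_grid {k m : ℕ}
    {S : Set (Fin (2 * (k + 1)) × Fin (2 * m + 1))}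
    (hS : IsGlobalOffensiveAlliance
      ((pathGraph (2 * (k + 1))).boxProd (pathGraph (2 * m + 1))) S) :
    2 * (k + 1) * m + (2 * (k + 1) + 2) / 3 ≤ S.ncard := by
  classical
  set C : ℕ → ℕ → Prop := fun i j =>
    ∃ (hi : i < 2 * (k + 1)) (hj : j < 2 * m + 1), ((⟨i, hi⟩, ⟨j, hj⟩) : Fin _ × Fin _) ∉ S
    with hC
  have hthree : ∀ i j i₁ j₁ i₂ j₂, C i j → C i₁ j₁ → C i₂ j₂ →
      (((i + 1 = i₁ ∨ i₁ + 1 = i) ∧ j = j₁) ∨ ((j + 1 = j₁ ∨ j₁ + 1 = j) ∧ i = i₁)) →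
      (((i + 1 = i₂ ∨ i₂ + 1 = i) ∧ j = j₂) ∨ ((j + 1 = j₂ ∨ j₂ + 1 = j) ∧ i = i₂)) →
      i₁ = i₂ ∧ j₁ = j₂ := by
    rintro i j i₁ j₁ i₂ j₂ ⟨hi, hj, h⟩ ⟨hi₁, hj₁, h₁⟩ ⟨hi₂, hj₂, h₂⟩ e₁ e₂
    by_contra hne
    have := hS.two_mul_card_lt h (grid_ncard_neighborSet_le _)
      {(⟨i₁, hi₁⟩, ⟨j₁, hj₁⟩), (⟨i₂, hi₂⟩, ⟨j₂, hj₂⟩)} (by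
        intro u hu
        rw [mem_insert, mem_singleton] at hu
        rcases hu with rfl | rfl
        · exact ⟨(grid_adj_iff _ _).2 e₁, h₁⟩
        · exact ⟨(grid_adj_iff _ _).2 e₂, h₂⟩)
    rw [card_pair (by simpa [Fin.ext_iff] using hne)] at this
    omega
  have hcorner : ∀ i i', (i = 0 ∨ i + 1 = 2 * (k + 1)) → (i + 1 = i' ∨ i' + 1 = i) →
      C i 0 → ¬ C i' 0 := by
    rintro i i' hi e ⟨hi, hj, h⟩ ⟨hi', hj', h'⟩
    have := hS.two_mul_card_lt h (grid_ncard_neighborSet_corner_le _ (by assumption) rfl)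
      {(⟨i', hi'⟩, ⟨0, hj'⟩)} (by
        intro u hu
        rw [mem_singleton] at hu
        subst hu
        exact ⟨(grid_adj_iff _ _).2 (Or.inl ⟨e, rfl⟩), h'⟩)
    simp at this
  have hbound := sum_array_le_of_matching (fun i j => if C i j then 1 else 0) k m
    (fun i j => by split_ifs <;> simp)
    (fun i j _ _ => by
      have h1 := hthree i j i (j + 1) (i + 1) j
      have h2 := hthree i (j + 1) i j (i + 1) (j + 1)
      have h3 := hthree (i + 1) j i j (i + 1) (j + 1)
      have h4 := hthree (i + 1) (j + 1) i (j + 1) (i + 1) j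
      by_cases a : C i j <;> by_cases b : C i (j + 1) <;> by_cases c : C (i + 1) j <;>
        by_cases d : C (i + 1) (j + 1) <;> simp only [a, b, c, d, if_true, if_false] <;>
        simp [a, b, c, d] at h1 h2 h3 h4 ⊢)
    (fun i j _ _ => by
      have h1 := hthree (i + 1) j i j (i + 2) j
      by_cases a : C i j <;> by_cases b : C (i + 1) j <;> by_cases c : C (i + 2) j <;>
        simp [a, b, c] at h1 ⊢)
    (by
      have h1 := hcorner 0 1 (Or.inl rfl) (Or.inl rfl)
      by_cases a : C 0 0 <;> by_cases b : C 1 0 <;> simp [a, b] at h1 ⊢)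
    (by
      have h1 := hcorner (2 * k + 1) (2 * k) (Or.inr (by ring)) (Or.inr rfl)
      by_cases a : C (2 * k) 0 <;> by_cases b : C (2 * k + 1) 0 <;> simp [a, b] at h1 ⊢)
  rw [← ncard_setOf_fin_prod] at hbound
  have hcompl : {p : Fin (2 * (k + 1)) × Fin (2 * m + 1) | C p.1 p.2} = Sᶜ := by
    ext ⟨⟨a, ha⟩, ⟨b, hb⟩⟩
    simp only [hC, ha, hb, exists_true_left, Set.mem_ofPred_eq, Set.mem_compl_iff]
  rw [hcompl] at hbound
  have hcard := Set.ncard_add_ncard_compl S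
  rw [Nat.card_prod, Nat.card_fin, Nat.card_fin] at hcard
  nlinarith

/-- The rows of the optimal alliance containing the even-numbered columns. -/
abbrev IsDenseRow (r i : ℕ) : Prop := i % 3 = 1 ∨ (i + 1 = r ∧ r % 3 = 1)

/-- The optimal alliance in a grid with an even number of rows and an odd number of columns. -/
def gridAlliance (r t : ℕ) : Set (Fin r × Fin t) :=
  {p | p.2.val % 2 = 0 ↔ IsDenseRow r p.1.val}

theorem isGlobalOffensiveAlliance_gridAlliance (r t : ℕ) (ht : 3 ≤ t)
    (hre : r % 2 = 0) (hto : t % 2 = 1) :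
    IsGlobalOffensiveAlliance ((pathGraph r).boxProd (pathGraph t)) (gridAlliance r t) := by
  rintro ⟨⟨a, ha⟩, ⟨b, hb⟩⟩ hv
  simp only [gridAlliance, IsDenseRow, Set.mem_ofPred_eq] at hv
  have hout : ((((pathGraph r).boxProd (pathGraph t)).neighborSet (⟨a, ha⟩, ⟨b, hb⟩)) \
      gridAlliance r t).ncard ≤ 1 := by
    have huniq : ∀ p ∈ (((pathGraph r).boxProd (pathGraph t)).neighborSet (⟨a, ha⟩, ⟨b, hb⟩)) \
        gridAlliance r t, p.1.val = (if a % 3 = 0 then a - 1 else a + 1) ∧ p.2.val = b := by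
      rintro ⟨⟨c, hc⟩, ⟨d, hd⟩⟩ ⟨hp, hp'⟩
      simp only [gridAlliance, IsDenseRow, Set.mem_ofPred_eq, mem_neighborSet, grid_adj_iff]
        at hp hp'
      dsimp only
      rcases hp with ⟨hp, rfl⟩ | ⟨hp, rfl⟩
      · rcases hp with rfl | rfl <;> split_ifs <;> omega
      · omega
    rw [Set.ncard_le_one]
    intro p hp q hq
    obtain ⟨hp1, hp2⟩ := huniq p hp
    obtain ⟨hq1, hq2⟩ := huniq q hq
    exact Prod.ext (Fin.ext (hp1.trans hq1.symm)) (Fin.ext (hp2.trans hq2.symm))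
  have hin : ∃ u w, u ≠ w ∧
      {u, w} ⊆ (((pathGraph r).boxProd (pathGraph t)).neighborSet (⟨a, ha⟩, ⟨b, hb⟩)) ∩
        gridAlliance r t := by
    have hb' : ∃ f, f < t ∧ (b + 1 = f ∨ f + 1 = b) := by
      rcases Nat.eq_zero_or_pos b with h | h
      · exact ⟨1, by omega, by omega⟩
      · exact ⟨b - 1, by omega, by omega⟩
    obtain ⟨f, hf, hbf⟩ := hb'
    have hother : ∃ c d, ∃ (_ : c < r) (_ : d < t), ¬ (c = a ∧ d = f) ∧
        (((a + 1 = c ∨ c + 1 = a) ∧ b = d) ∨ ((b + 1 = d ∨ d + 1 = b) ∧ a = c)) ∧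
        (d % 2 = 0 ↔ (c % 3 = 1 ∨ (c + 1 = r ∧ r % 3 = 1))) := by
      by_cases hd : a % 3 = 1 ∨ (a + 1 = r ∧ r % 3 = 1)
      · by_cases hfb : f = b + 1
        · exact ⟨a, b - 1, ha, by omega, by omega, by omega, by omega⟩
        · exact ⟨a, b + 1, ha, by omega, by omega, by omega, by omega⟩
      · by_cases hup : a % 3 = 0
        · exact ⟨a + 1, b, by omega, by omega, by omega, by omega, by omega⟩
        · exact ⟨a - 1, b, by omega, by omega, by omega, by omega, by omega⟩
    obtain ⟨c, d, hc, hd, hne, hadj, hmem⟩ := hother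
    refine ⟨(⟨c, hc⟩, ⟨d, hd⟩), (⟨a, ha⟩, ⟨f, hf⟩), by simpa [Fin.ext_iff] using hne, ?_⟩
    rintro p (rfl | rfl)
    · exact ⟨(grid_adj_iff _ _).2 hadj, hmem⟩
    · refine ⟨(grid_adj_iff _ _).2 (Or.inr ⟨hbf, rfl⟩), ?_⟩
      simp only [gridAlliance, IsDenseRow, Set.mem_ofPred_eq]
      omega
  obtain ⟨u, w, huw, hsub⟩ := hin
  have := Set.ncard_le_ncard hsub (Set.toFinite _)
  rw [Set.ncard_pair huw] at this
  omega

open Finset in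
theorem ncard_gridAlliance (r m : ℕ) (hr : r ≠ 0) :
    (gridAlliance r (2 * m + 1)).ncard = r * m + (r + 2) / 3 := by
  unfold gridAlliance
  rw [ncard_setOf_fin_prod r (2 * m + 1) (fun i j => j % 2 = 0 ↔ IsDenseRow r i)]
  have hrow : ∀ i, (∑ j ∈ range (2 * m + 1), if (j % 2 = 0 ↔ IsDenseRow r i) then 1 else 0) =
      m + if IsDenseRow r i then 1 else 0 := by
    intro i
    by_cases h : IsDenseRow r i <;> simp only [h, iff_true, iff_false, if_true, if_false]
    all_goals
      induction m with
      | zero => rw [sum_range_one]; rfl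
      | succ m ih =>
        rw [show 2 * (m + 1) + 1 = 2 * m + 1 + 1 + 1 by ring, sum_range_succ, sum_range_succ, ih]
        have h1 : (2 * m + 1) % 2 = 1 := by omega
        have h2 : (2 * m + 1 + 1) % 2 = 0 := by omega
        rw [h1, h2]
        simp
  have hmod : ∀ n, (∑ i ∈ range n, if i % 3 = 1 then 1 else 0) = (n + 1) / 3 := by
    intro n
    induction n with
    | zero => simp
    | succ n ih =>
      rw [sum_range_succ, ih]
      split_ifs <;> omega
  simp_rw [hrow]
  rw [sum_add_distrib, sum_const, card_range, smul_eq_mul]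
  congr 1
  obtain ⟨n, rfl⟩ := Nat.exists_eq_succ_of_ne_zero hr
  rw [Nat.succ_eq_add_one, sum_range_succ, sum_congr rfl (g := fun i => if i % 3 = 1 then 1 else 0)]
  · rw [hmod]
    simp only [IsDenseRow, true_and]
    split_ifs <;> omega
  · intro i hi
    rw [mem_range] at hi
    simp only [IsDenseRow]
    split_ifs <;> omega

theorem stmt18 (r t : ℕ) (hr : 2 ≤ r) (ht : 3 ≤ t) (hre : Even r) (hto : Odd t) :
    globalOffensiveAllianceNumber ((pathGraph r).boxProd (pathGraph t)) =
      r * (t - 1) / 2 + (r + 2) / 3 := by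
  obtain ⟨m, rfl⟩ := hto
  have hhalf : r * (2 * m + 1 - 1) / 2 = r * m := by
    rw [Nat.add_sub_cancel, mul_left_comm, Nat.mul_div_cancel_left _ two_pos]
  rw [hhalf]
  have hmem : r * m + (r + 2) / 3 ∈ {n | ∃ S : Set (Fin r × Fin (2 * m + 1)),
      IsGlobalOffensiveAlliance ((pathGraph r).boxProd (pathGraph (2 * m + 1))) S ∧
        S.ncard = n} :=
    ⟨gridAlliance r (2 * m + 1),
      isGlobalOffensiveAlliance_gridAlliance r _ ht (Nat.even_iff.1 hre) (by omega),
      ncard_gridAlliance r m (by omega)⟩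
  refine le_antisymm (Nat.sInf_le hmem) (le_csInf ⟨_, hmem⟩ ?_)
  rintro _ ⟨S, hS, rfl⟩
  obtain ⟨k, rfl⟩ : ∃ k, r = 2 * (k + 1) := by
    obtain ⟨k, rfl⟩ := hre
    exact ⟨k - 1, by omega⟩
  exact hS.le_ncard_grid
end

section
/- Let r ≥ 2 and t ≥ 3 be integers. The global offensive alliance number of the cylinder graph P_r □ C_t equals γo(P_r □ C_t) = r·t/2 if r is even, and γo(P_r □ C_t) = (r−1)·t/2 + ⌈t/3⌉ if r is odd, where P_r is the path graph on r vertices and C_t is the cycle graph on t vertices. -/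
open SimpleGraph

lemma cycleGraph_adj_iff_eq_add_one {n : ℕ} (u v : Fin (n + 3)) :
    (cycleGraph (n + 3)).Adj u v ↔ v = u + 1 ∨ u = v + 1 := by
  rw [cycleGraph_adj, sub_eq_iff_eq_add', sub_eq_iff_eq_add', or_comm]

lemma Fin.add_one_add_one_ne_self {n : ℕ} (c : Fin (n + 3)) : c + 1 + 1 ≠ c := by
  rw [add_assoc, Ne, add_eq_left]
  exact fun h ↦ by simpa [Fin.val_add, Nat.mod_eq_of_lt] using congrArg Fin.val h

lemma Set.ncard_prod_fin_eq_sum {r t : ℕ} (S : Set (Fin r × Fin t)) [DecidablePred (· ∈ S)] :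
    S.ncard = ∑ i, ∑ c, if (i, c) ∈ S then 1 else 0 := by
  rw [← Fintype.sum_prod_type (f := fun p ↦ if p ∈ S then 1 else 0), ← Finset.card_filter,
    ← Set.ncard_coe_finset]
  simp

lemma ncard_neighborSet_cylinder_le {r n : ℕ} (v : Fin r × Fin (n + 3)) :
    (((pathGraph r).boxProd (cycleGraph (n + 3))).neighborSet v).ncard ≤ 4 := by
  obtain ⟨i, c⟩ := v
  have hpath : ((pathGraph r).neighborSet i).ncard ≤ 2 := by
    rw [← Set.ncard_image_of_injective _ Fin.val_injective]
    refine (Set.ncard_le_ncard (t := {i.val + 1, i.val - 1}) ?_).trans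
      ((Set.ncard_insert_le _ _).trans (by simp))
    rintro _ ⟨j, hj, rfl⟩
    rw [mem_neighborSet, pathGraph_adj] at hj
    simp only [Set.mem_insert_iff, Set.mem_singleton_iff]
    omega
  have hcycle : ((cycleGraph (n + 3)).neighborSet c).ncard ≤ 2 := by
    refine (Set.ncard_le_ncard (t := {c + 1, c - 1}) ?_).trans
      ((Set.ncard_insert_le _ _).trans (by simp))
    intro d hd
    rw [mem_neighborSet, cycleGraph_adj_iff_eq_add_one] at hd
    exact hd.imp id fun h ↦ eq_sub_of_add_eq h.symm
  rw [neighborSet_boxProd]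
  refine (Set.ncard_union_le _ _).trans ?_
  rw [Set.ncard_prod, Set.ncard_prod, Set.ncard_singleton, Set.ncard_singleton]
  dsimp only
  omega

lemma IsGlobalOffensiveAlliance.eq_of_adj_of_ncard_neighborSet_le {V : Type*} [Finite V]
    {G : SimpleGraph V} {S : Set V} (hS : IsGlobalOffensiveAlliance G S) {v a b : V}
    (hdeg : (G.neighborSet v).ncard ≤ 4) (hv : v ∉ S) (ha : G.Adj v a) (hb : G.Adj v b)
    (haS : a ∉ S) (hbS : b ∉ S) : a = b := by
  have h := hS v hv
  have hsum := Set.ncard_inter_add_ncard_sdiff_eq_ncard (G.neighborSet v) S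
  exact (Set.ncard_le_one (s := G.neighborSet v \ S)).1 (by omega) a ⟨ha, haS⟩ b ⟨hb, hbS⟩

lemma IsGlobalOffensiveAlliance.of_adj {V : Type*} [Finite V] {G : SimpleGraph V} {S : Set V}
    (h : ∀ v ∉ S, ∃ a b c, a ≠ b ∧ G.Adj v a ∧ G.Adj v b ∧ a ∈ S ∧ b ∈ S ∧
      ∀ d, G.Adj v d → d ∉ S → d = c) : IsGlobalOffensiveAlliance G S := by
  intro v hv
  obtain ⟨a, b, c, hab, ha, hb, haS, hbS, hc⟩ := h v hv
  have hin : 2 ≤ (G.neighborSet v ∩ S).ncard := by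
    rw [← Set.ncard_pair hab]
    exact Set.ncard_le_ncard (Set.pair_subset ⟨ha, haS⟩ ⟨hb, hbS⟩)
  have hout : (G.neighborSet v \ S).ncard ≤ 1 := by
    rw [← Set.ncard_singleton c]
    exact Set.ncard_le_ncard fun d hd ↦ hc d hd.1 hd.2
  omega

/-- The number of vertices of `S` in the `i`-th cycle of the cylinder. -/
noncomputable def rowCard {r t : ℕ} (S : Set (Fin r × Fin t)) (i : Fin r) : ℕ :=
  open Classical in ∑ c, if (i, c) ∈ S then 1 else 0

lemma le_three_mul_rowCard {r n : ℕ} {S : Set (Fin r × Fin (n + 3))}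
    (hS : IsGlobalOffensiveAlliance ((pathGraph r).boxProd (cycleGraph (n + 3))) S) (i : Fin r) :
    n + 3 ≤ 3 * rowCard S i := by
  classical
  let f : Fin (n + 3) → ℕ := fun c ↦ if (i, c) ∈ S then 1 else 0
  have hone : ∑ c, f (c + 1) = ∑ c, f c := Equiv.sum_comp (Equiv.addRight 1) f
  have htwo : ∑ c, f (c + 1 + 1) = ∑ c, f (c + 1) :=
    Equiv.sum_comp (Equiv.addRight 1) fun c ↦ f (c + 1)
  have hwindow : ∀ c, 1 ≤ f c + f (c + 1) + f (c + 1 + 1) := by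
    intro c
    by_contra! hlt
    have h0 : (i, c) ∉ S := fun h ↦ by simp [f, h] at hlt
    have h1 : (i, c + 1) ∉ S := fun h ↦ by simp [f, h] at hlt
    have h2 : (i, c + 1 + 1) ∉ S := fun h ↦ by simp [f, h] at hlt
    have := hS.eq_of_adj_of_ncard_neighborSet_le (ncard_neighborSet_cylinder_le _) h1
      (a := (i, c)) (b := (i, c + 1 + 1))
      (by simp [boxProd_adj, cycleGraph_adj_iff_eq_add_one])
      (by simp [boxProd_adj, cycleGraph_adj_iff_eq_add_one]) h0 h2
    exact Fin.add_one_add_one_ne_self c (congrArg Prod.snd this).symm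
  have hsum := Finset.sum_le_sum fun c (_ : c ∈ Finset.univ) ↦ hwindow c
  simp only [Finset.sum_add_distrib, Finset.sum_const, Finset.card_univ, Fintype.card_fin,
    smul_eq_mul, mul_one] at hsum
  have hrow : rowCard S i = ∑ c, f c := by simp [rowCard, f]
  omega

lemma le_rowCard_add_rowCard {r n : ℕ} {S : Set (Fin r × Fin (n + 3))}
    (hS : IsGlobalOffensiveAlliance ((pathGraph r).boxProd (cycleGraph (n + 3))) S) {i j : Fin r}
    (hij : (pathGraph r).Adj i j) : n + 3 ≤ rowCard S i + rowCard S j := by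
  classical
  let f : Fin r → Fin (n + 3) → ℕ := fun k c ↦ if (k, c) ∈ S then 1 else 0
  let w : Fin (n + 3) → ℕ := fun c ↦ f i c + f j c
  have hrow : ∀ k, rowCard S k = ∑ c, f k c := fun k ↦ by simp [rowCard, f]
  have hone : ∑ c, w (c + 1) = ∑ c, w c := Equiv.sum_comp (Equiv.addRight 1) w
  have hfull : ∀ k l : Fin r, (pathGraph r).Adj k l → ∀ c d, (cycleGraph (n + 3)).Adj c d →
      (k, c) ∉ S → (l, c) ∉ S → (k, d) ∈ S := by
    intro k l hkl c d hcd hk hl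
    by_contra hd
    have := hS.eq_of_adj_of_ncard_neighborSet_le (ncard_neighborSet_cylinder_le _) hk
      (a := (l, c)) (b := (k, d)) (by simp [boxProd_adj, hkl]) (by simp [boxProd_adj, hcd]) hl hd
    exact hkl.ne (congrArg Prod.fst this).symm
  have hcolumns : ∀ c d, (cycleGraph (n + 3)).Adj c d → w c = 0 → w d = 2 := by
    intro c d hcd hc
    have hi : (i, c) ∉ S := fun h ↦ by simp [w, f, h] at hc
    have hj : (j, c) ∉ S := fun h ↦ by simp [w, f, h] at hc
    simp [w, f, hfull i j hij c d hcd hi hj, hfull j i hij.symm c d hcd hj hi]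
  have hpair : ∀ c, 2 ≤ w c + w (c + 1) := by
    intro c
    have hadj : (cycleGraph (n + 3)).Adj c (c + 1) := by simp [cycleGraph_adj_iff_eq_add_one]
    have := hcolumns c (c + 1) hadj
    have := hcolumns (c + 1) c hadj.symm
    omega
  have hsum := Finset.sum_le_sum fun c (_ : c ∈ Finset.univ) ↦ hpair c
  simp only [Finset.sum_add_distrib, Finset.sum_const, Finset.card_univ, Fintype.card_fin,
    smul_eq_mul, hone] at hsum
  have hw : ∑ c, w c = rowCard S i + rowCard S j := by
    rw [hrow, hrow, ← Finset.sum_add_distrib]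
  omega

lemma Finset.mul_le_sum_range_two_mul {f : ℕ → ℕ} {t k : ℕ}
    (h : ∀ i, i + 1 < 2 * k → t ≤ f i + f (i + 1)) : k * t ≤ ∑ i ∈ range (2 * k), f i := by
  induction k with
  | zero => simp
  | succ k ih =>
    rw [Nat.mul_succ, sum_range_succ, sum_range_succ, Nat.succ_mul]
    have := ih fun i hi ↦ h i (by omega)
    have := h (2 * k) (by omega)
    omega

lemma Finset.sum_range_two_mul_ite_even (a b k : ℕ) :
    ∑ i ∈ range (2 * k), (if Even i then a else b) = k * (a + b) := by
  induction k with
  | zero => simp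
  | succ k ih =>
    rw [Nat.mul_succ, sum_range_succ, sum_range_succ, ih]
    simp
    ring

/-- Columns of the cycle hit by the extremal alliance in the rows of even index. -/
def IsSparseColumn {t : ℕ} (c : Fin t) : Prop := c.val % 3 = 2 ∨ c.val + 1 = t

instance {t : ℕ} : DecidablePred (IsSparseColumn (t := t)) :=
  fun c ↦ inferInstanceAs (Decidable (c.val % 3 = 2 ∨ c.val + 1 = t))

lemma sum_range_ite_mod_three_eq_two (m : ℕ) :
    ∑ c ∈ Finset.range m, (if c % 3 = 2 then 1 else 0) = m / 3 := by
  induction m with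
  | zero => simp
  | succ m ih =>
    rw [Finset.sum_range_succ, ih]
    split_ifs <;> omega

lemma sum_ite_isSparseColumn {t : ℕ} (ht : 0 < t) :
    ∑ c : Fin t, (if IsSparseColumn c then 1 else 0) = (t + 2) / 3 := by
  obtain ⟨m, rfl⟩ := Nat.exists_eq_add_of_lt ht
  refine (Fin.sum_univ_eq_sum_range
    (fun c ↦ if c % 3 = 2 ∨ c + 1 = 0 + m + 1 then 1 else 0) _).trans ?_
  rw [Finset.sum_range_succ, zero_add]
  rw [Finset.sum_congr rfl (g := fun c ↦ if c % 3 = 2 then 1 else 0),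
    sum_range_ite_mod_three_eq_two]
  · simp
    omega
  · intro c hc
    rw [Finset.mem_range] at hc
    simp [hc.ne]

/-- The extremal global offensive alliance of the cylinder. -/
def cylinderAlliance (r t : ℕ) : Set (Fin r × Fin t) :=
  {p | Even p.1.val ↔ IsSparseColumn p.2}

lemma exists_cycleGraph_adj_isSparseColumn_iff_not {n : ℕ} (c : Fin (n + 3)) :
    ∃ d e, (cycleGraph (n + 3)).Adj c d ∧ (IsSparseColumn d ↔ ¬ IsSparseColumn c) ∧
      ∀ x, (cycleGraph (n + 3)).Adj c x → (IsSparseColumn x ↔ IsSparseColumn c) → x = e := by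
  have hnext : (c + 1).val = if c.val = n + 2 then 0 else c.val + 1 := by
    simp [Fin.val_add_one, Fin.ext_iff]
  have hprev : (c - 1).val = if c.val = 0 then n + 2 else c.val - 1 := by
    have h : (c - 1 + 1).val = if (c - 1).val = n + 2 then 0 else (c - 1).val + 1 := by
      rw [Fin.val_add_one]
      simp [Fin.ext_iff]
    rw [sub_add_cancel] at h
    have := (c - 1).isLt
    split_ifs at h ⊢ <;> omega
  have hadj : ∀ x, (cycleGraph (n + 3)).Adj c x ↔ x = c + 1 ∨ x = c - 1 := fun x ↦ by
    rw [cycleGraph_adj_iff_eq_add_one, eq_sub_iff_add_eq, eq_comm (a := c)]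
  have hc := c.isLt
  have hopp : (IsSparseColumn (c + 1) ↔ ¬ IsSparseColumn c) ∨
      (IsSparseColumn (c - 1) ↔ ¬ IsSparseColumn c) := by
    simp only [IsSparseColumn]
    split_ifs at hnext hprev <;> omega
  rcases hopp with h | h
  · refine ⟨c + 1, c - 1, (hadj _).2 (.inl rfl), h, fun x hx hxc ↦ ?_⟩
    rcases (hadj x).1 hx with rfl | rfl
    · tauto
    · rfl
  · refine ⟨c - 1, c + 1, (hadj _).2 (.inr rfl), h, fun x hx hxc ↦ ?_⟩
    rcases (hadj x).1 hx with rfl | rfl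
    · rfl
    · tauto

lemma even_iff_not_even_of_pathGraph_adj {r : ℕ} {i j : Fin r} (h : (pathGraph r).Adj i j) :
    Even j.val ↔ ¬ Even i.val := by
  rw [pathGraph_adj] at h
  simp only [Nat.even_iff]
  omega

lemma exists_pathGraph_adj {r : ℕ} (hr : 2 ≤ r) (i : Fin r) : ∃ j, (pathGraph r).Adj i j := by
  simp only [pathGraph_adj]
  by_cases h : i.val + 1 < r
  · exact ⟨⟨i + 1, h⟩, .inl rfl⟩
  · exact ⟨⟨i - 1, by omega⟩, .inr (by simp only; omega)⟩

lemma isGlobalOffensiveAlliance_cylinderAlliance {r n : ℕ} (hr : 2 ≤ r) :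
    IsGlobalOffensiveAlliance ((pathGraph r).boxProd (cycleGraph (n + 3)))
      (cylinderAlliance r (n + 3)) := by
  refine .of_adj ?_
  rintro ⟨i, c⟩ hv
  obtain ⟨j, hj⟩ := exists_pathGraph_adj hr i
  obtain ⟨d, e, hd, hdc, he⟩ := exists_cycleGraph_adj_isSparseColumn_iff_not c
  have hmem : ∀ k x, (k, x) ∈ cylinderAlliance r (n + 3) ↔ (Even k.val ↔ IsSparseColumn x) :=
    fun _ _ ↦ Iff.rfl
  rw [hmem] at hv
  refine ⟨(j, c), (i, d), (i, e), fun h ↦ hj.ne (congrArg Prod.fst h).symm,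
    by simp [boxProd_adj, hj], by simp [boxProd_adj, hd], ?_, ?_, ?_⟩
  · have := even_iff_not_even_of_pathGraph_adj hj
    rw [hmem]
    grind
  · rw [hmem]
    grind
  · rintro ⟨k, x⟩ hadj hx
    rw [hmem] at hx
    rcases boxProd_adj.1 hadj with ⟨hk, rfl⟩ | ⟨hk, rfl⟩
    · have := even_iff_not_even_of_pathGraph_adj hk
      dsimp only at this hx hv
      tauto
    · rw [he x hk (by grind)]

lemma ncard_cylinderAlliance (r : ℕ) {t : ℕ} (ht : 0 < t) :
    (cylinderAlliance r t).ncard =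
      ∑ i ∈ Finset.range r, if Even i then (t + 2) / 3 else t - (t + 2) / 3 := by
  classical
  rw [Set.ncard_prod_fin_eq_sum, ← Fin.sum_univ_eq_sum_range]
  refine Finset.sum_congr rfl fun i _ ↦ ?_
  have hsparse := sum_ite_isSparseColumn ht
  split_ifs with hi
  · simpa [cylinderAlliance, hi] using hsparse
  · have htotal : ∑ c : Fin t, ((if IsSparseColumn c then 1 else 0) +
        (if IsSparseColumn c then 0 else 1)) = t := by
      rw [Finset.sum_congr rfl (g := fun _ ↦ 1) fun c _ ↦ by split_ifs <;> rfl]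
      simp
    rw [Finset.sum_add_distrib, hsparse] at htotal
    rw [← Nat.eq_sub_of_add_eq' htotal]
    refine Finset.sum_congr rfl fun c _ ↦ ?_
    by_cases h : IsSparseColumn c <;> simp [cylinderAlliance, hi, h]

lemma globalOffensiveAllianceNumber_eq_ncard {V : Type*} {G : SimpleGraph V} {S : Set V}
    (hS : IsGlobalOffensiveAlliance G S)
    (hmin : ∀ T, IsGlobalOffensiveAlliance G T → S.ncard ≤ T.ncard) :
    globalOffensiveAllianceNumber G = S.ncard := by
  refine le_antisymm (Nat.sInf_le ⟨S, hS, rfl⟩) (le_csInf ⟨_, S, hS, rfl⟩ ?_)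
  rintro _ ⟨T, hT, rfl⟩
  exact hmin T hT

lemma ncard_cylinderAlliance_two_mul (k : ℕ) {t : ℕ} (ht : 0 < t) :
    (cylinderAlliance (2 * k) t).ncard = k * t := by
  rw [ncard_cylinderAlliance _ ht, Finset.sum_range_two_mul_ite_even]
  congr 1
  omega

lemma ncard_cylinderAlliance_two_mul_add_one (k : ℕ) {t : ℕ} (ht : 0 < t) :
    (cylinderAlliance (2 * k + 1) t).ncard = k * t + (t + 2) / 3 := by
  rw [ncard_cylinderAlliance _ ht, Finset.sum_range_succ, ← ncard_cylinderAlliance _ ht,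
    ncard_cylinderAlliance_two_mul k ht]
  simp

lemma exists_ncard_eq_sum_range_of_isGlobalOffensiveAlliance {r n : ℕ}
    {S : Set (Fin r × Fin (n + 3))}
    (hS : IsGlobalOffensiveAlliance ((pathGraph r).boxProd (cycleGraph (n + 3))) S) :
    ∃ f : ℕ → ℕ, S.ncard = ∑ i ∈ Finset.range r, f i ∧ (∀ i < r, n + 3 ≤ 3 * f i) ∧
      ∀ i, i + 1 < r → n + 3 ≤ f i + f (i + 1) := by
  classical
  let f : ℕ → ℕ := fun i ↦ if h : i < r then rowCard S ⟨i, h⟩ else 0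
  have hf : ∀ i (h : i < r), f i = rowCard S ⟨i, h⟩ := fun i h ↦ dif_pos h
  refine ⟨f, ?_, fun i hi ↦ ?_, fun i hi ↦ ?_⟩
  · rw [Set.ncard_prod_fin_eq_sum, ← Fin.sum_univ_eq_sum_range]
    exact Finset.sum_congr rfl fun i _ ↦ by simp [hf, rowCard]
  · rw [hf i hi]
    exact le_three_mul_rowCard hS _
  · rw [hf i (by omega), hf (i + 1) hi]
    exact le_rowCard_add_rowCard hS (pathGraph_adj.2 (.inl rfl))

theorem stmt19 (r t : ℕ) (hr : 2 ≤ r) (ht : 3 ≤ t) :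
    (Even r →
      globalOffensiveAllianceNumber ((pathGraph r).boxProd (cycleGraph t)) = r * t / 2) ∧
    (Odd r →
      globalOffensiveAllianceNumber ((pathGraph r).boxProd (cycleGraph t)) =
        (r - 1) * t / 2 + (t + 2) / 3) := by
  obtain ⟨n, rfl⟩ := Nat.exists_eq_add_of_le' ht
  refine ⟨fun heven ↦ ?_, fun hodd ↦ ?_⟩
  · obtain ⟨k, rfl⟩ := heven.two_dvd
    rw [globalOffensiveAllianceNumber_eq_ncard
      (isGlobalOffensiveAlliance_cylinderAlliance hr) fun T hT ↦ ?_]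
    · rw [ncard_cylinderAlliance_two_mul k (by omega), mul_assoc, Nat.mul_div_cancel_left _ two_pos]
    · obtain ⟨f, hsum, -, hpair⟩ := exists_ncard_eq_sum_range_of_isGlobalOffensiveAlliance hT
      rw [ncard_cylinderAlliance_two_mul k (by omega), hsum]
      exact Finset.mul_le_sum_range_two_mul hpair
  · obtain ⟨k, rfl⟩ := hodd
    rw [globalOffensiveAllianceNumber_eq_ncard
      (isGlobalOffensiveAlliance_cylinderAlliance hr) fun T hT ↦ ?_]
    · rw [ncard_cylinderAlliance_two_mul_add_one k (by omega), Nat.add_sub_cancel, mul_assoc,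
        Nat.mul_div_cancel_left _ two_pos]
    · obtain ⟨f, hsum, hrow, hpair⟩ := exists_ncard_eq_sum_range_of_isGlobalOffensiveAlliance hT
      rw [ncard_cylinderAlliance_two_mul_add_one k (by omega), hsum, Finset.sum_range_succ]
      have := hrow (2 * k) (by omega)
      have := Finset.mul_le_sum_range_two_mul (f := f) (t := n + 3) (k := k)
        fun i hi ↦ hpair i (by omega)
      omega
end
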